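/- arXiv:2210.04550 — 4 statements merged into one kernel-verified Lean document; each statement's English description precedes it below -/
import Mathlib

section
/- For every positive integer n, there exists an almost perfect linear Lee code of packing radius 2 in ℤⁿ if and only if there exist a finite abelian group H of order n²+n+1 and two inverse-closed subsets T₀, T₁ of H with e ∈ T₀ satisfying the APLL group-ring equations. -/
open scoped Classical Pointwise

/-- The APLL group-ring equations, stated via coefficient counts: for every `h ∈ H`,
`#{(a,b) ∈ T₀×T₁ : ab = h} = 1 − [h = e]`, and
`#{(a,b) ∈ T₀×T₀ : ab = h} + #{(a,b) ∈ T₁×T₁ : ab = h} + #{t ∈ T₀ : t² = h}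
  + #{t ∈ T₁ : t² = h} = 2 + 2n·[h = e]`. -/
def APLLEqs {H : Type*} [CommGroup H] (n : ℕ) (T₀ T₁ : Set H) : Prop :=
  (∀ h : H,
      {p : H × H | p.1 ∈ T₀ ∧ p.2 ∈ T₁ ∧ p.1 * p.2 = h}.ncard
        = if h = 1 then 0 else 1) ∧
  (∀ h : H,
      {p : H × H | p.1 ∈ T₀ ∧ p.2 ∈ T₀ ∧ p.1 * p.2 = h}.ncard
        + {p : H × H | p.1 ∈ T₁ ∧ p.2 ∈ T₁ ∧ p.1 * p.2 = h}.ncard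
        + {t : H | t ∈ T₀ ∧ t ^ 2 = h}.ncard
        + {t : H | t ∈ T₁ ∧ t ^ 2 = h}.ncard
        = 2 + if h = 1 then 2 * n else 0)

/-- `Xset T₀ T₁ i` is the set of `h ∈ H` appearing with coefficient `i` in `T̂⁽²⁾T₀`. -/
def Xset {H : Type*} [CommGroup H] (T₀ T₁ : Set H) (i : ℕ) : Set H :=
  {h : H | {p : H × H | p.1 ∈ T₀ ∪ T₁ ∧ p.2 ∈ T₀ ∧ p.1 ^ 2 * p.2 = h}.ncard = i}

/-- `Yset T₀ T₁ i` is the set of `h ∈ H` appearing with coefficient `i` in `T̂⁽²⁾T₁`. -/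
def Yset {H : Type*} [CommGroup H] (T₀ T₁ : Set H) (i : ℕ) : Set H :=
  {h : H | {p : H × H | p.1 ∈ T₀ ∪ T₁ ∧ p.2 ∈ T₁ ∧ p.1 ^ 2 * p.2 = h}.ncard = i}

/-- `Vset T₀ T₁ i` is the set of `h ∈ H` appearing with coefficient `i` in `T̂⁽⁴⁾T₁`. -/
def Vset {H : Type*} [CommGroup H] (T₀ T₁ : Set H) (i : ℕ) : Set H :=
  {h : H | {p : H × H | p.1 ∈ T₀ ∪ T₁ ∧ p.2 ∈ T₁ ∧ p.1 ^ 4 * p.2 = h}.ncard = i}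

/-- `θ₀ = |(T₀T₀ ∖ T₀⁽²⁾) ∩ T̂⁽⁴⁾|`. -/
noncomputable def theta0 {H : Type*} [CommGroup H] (T₀ T₁ : Set H) : ℕ :=
  (((T₀ * T₀) \ ((fun t => t ^ 2) '' T₀)) ∩ ((fun g => g ^ 4) '' (T₀ ∪ T₁))).ncard

/-- `θ₁ = |T₁ ∩ T̂⁽²⁾|/2 + |(T₁T₁ ∖ (T₁⁽²⁾ ∪ {e})) ∩ T̂⁽⁴⁾|`, as a rational number. -/
noncomputable def theta1 {H : Type*} [CommGroup H] (T₀ T₁ : Set H) : ℚ :=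
  ((T₁ ∩ ((fun g => g ^ 2) '' (T₀ ∪ T₁))).ncard : ℚ) / 2
    + ((((T₁ * T₁) \ (((fun t => t ^ 2) '' T₁) ∪ {1}))
        ∩ ((fun g => g ^ 4) '' (T₀ ∪ T₁))).ncard : ℚ)

/-- `s_i = (i−1)(i−4)/2` if `i ≡ 1 (mod 3)`, and `(i−2)(i−3)/2` otherwise. -/
def sCoef (i : ℕ) : ℚ :=
  if i % 3 = 1 then ((i : ℚ) - 1) * ((i : ℚ) - 4) / 2
  else ((i : ℚ) - 2) * ((i : ℚ) - 3) / 2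

/-- The Lee sphere of radius 2 in `ℤⁿ`: `S(n,2) = {x ∈ ℤⁿ : Σᵢ |xᵢ| ≤ 2}`. -/
def LeeSphere2 (n : ℕ) : Set (Fin n → ℤ) := {x | (∑ i, |x i|) ≤ 2}

/-- An almost perfect linear Lee (APLL) code of packing radius 2 in `ℤⁿ`:
a subgroup `C` of `ℤⁿ` of index `2n²+2n+2 = |S(n,2)|+1` such that the translates
`S(n,2)+c`, `c ∈ C`, are pairwise disjoint. -/
def IsAPLLCode (n : ℕ) (C : AddSubgroup (Fin n → ℤ)) : Prop :=
  C.index = 2 * n ^ 2 + 2 * n + 2 ∧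
  ∀ c₁ ∈ C, ∀ c₂ ∈ C, c₁ ≠ c₂ →
    Disjoint ((fun x => x + c₁) '' LeeSphere2 n) ((fun x => x + c₂) '' LeeSphere2 n)

/-- There exist inverse-closed subsets `T₀, T₁` of `H` with `e ∈ T₀` satisfying the
APLL group-ring equations, and `H` has order `n²+n+1`. -/
def GroupRingExistence (n : ℕ) (H : Type) [CommGroup H] [Fintype H] : Prop :=
  Fintype.card H = n ^ 2 + n + 1 ∧
  ∃ T₀ T₁ : Set H, T₀⁻¹ = T₀ ∧ T₁⁻¹ = T₁ ∧ (1 : H) ∈ T₀ ∧ APLLEqs n T₀ T₁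

/-- The unit vectors `±eᵢ` of `ℤⁿ` together with the origin. -/
def leeUnit {n : ℕ} : Option (Fin n × ℤˣ) → Fin n → ℤ
  | none => 0
  | some (i, ε) => Pi.single i (ε : ℤ)

/-- The Lee sphere of radius `1` in `ℤⁿ`. -/
def leeSphere1 (n : ℕ) : Set (Fin n → ℤ) := Set.range leeUnit

/-- The coefficient of `h` in `T² + T⁽²⁾`, written additively. -/
noncomputable def rep {G : Type*} [AddCommGroup G] (T : Set G) (h : G) : ℕ :=
  {p : G × G | p.1 ∈ T ∧ p.2 ∈ T ∧ p.1 + p.2 = h}.ncard + {t : G | t ∈ T ∧ 2 • t = h}.ncard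

/-- Sums of two elements of `T` determine the summands, unless they vanish. -/
def IsNonzeroSidon {G : Type*} [AddCommGroup G] (T : Set G) : Prop :=
  ∀ a ∈ T, ∀ b ∈ T, ∀ c ∈ T, ∀ d ∈ T, a + b = c + d → a + b ≠ 0 →
    (a = c ∧ b = d) ∨ (a = d ∧ b = c)

section LeeSphere

variable {n : ℕ}

lemma leeUnit_injective : Function.Injective (leeUnit (n := n)) := by
  rintro (_ | ⟨i, ε⟩) (_ | ⟨j, δ⟩) h
  · rfl
  · have := congrFun h j
    simp [leeUnit] at this
    exact absurd this.symm δ.ne_zero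
  · have := congrFun h i
    simp [leeUnit] at this
  · have hi := congrFun h i
    by_cases hij : i = j
    · subst hij
      simpa [leeUnit, Units.ext_iff] using hi
    · simp [leeUnit, hij] at hi

lemma ncard_leeSphere1 : (leeSphere1 n).ncard = 2 * n + 1 := by
  rw [leeSphere1, ← Set.image_univ, Set.ncard_image_of_injective _ leeUnit_injective,
    Set.ncard_univ]
  simp [Nat.card_eq_fintype_card, mul_comm]

lemma zero_mem_leeSphere1 : (0 : Fin n → ℤ) ∈ leeSphere1 n := ⟨none, rfl⟩

lemma single_mem_leeSphere1 (i : Fin n) (ε : ℤˣ) : Pi.single i (ε : ℤ) ∈ leeSphere1 n :=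
  ⟨some (i, ε), rfl⟩

lemma neg_mem_leeSphere1 {u : Fin n → ℤ} (hu : u ∈ leeSphere1 n) : -u ∈ leeSphere1 n := by
  obtain ⟨_ | ⟨i, ε⟩, rfl⟩ := hu
  · exact ⟨none, by simp [leeUnit]⟩
  · exact ⟨some (i, -ε), by simp [leeUnit, Pi.single_neg]⟩

lemma sum_abs_le_one_of_mem {u : Fin n → ℤ} (hu : u ∈ leeSphere1 n) : ∑ i, |u i| ≤ 1 := by
  obtain ⟨_ | ⟨i, ε⟩, rfl⟩ := hu
  · simp [leeUnit]
  · rw [Finset.sum_eq_single i]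
    · rcases Int.units_eq_one_or ε with rfl | rfl <;> simp [leeUnit]
    · intro j _ hj
      simp [leeUnit, hj]
    · simp

lemma exists_mem_leeSphere1_sum_abs_sub {x : Fin n → ℤ} (hx : x ≠ 0) :
    ∃ u ∈ leeSphere1 n, ∑ i, |(x - u) i| = ∑ i, |x i| - 1 := by
  obtain ⟨i, hi⟩ := Function.ne_iff.mp hx
  have key : ∃ ε : ℤˣ, |x i - ε| = |x i| - 1 := by
    rcases lt_or_gt_of_ne hi with h | h
    · refine ⟨-1, ?_⟩
      simp only [Pi.zero_apply, Units.val_neg, Units.val_one] at h ⊢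
      rw [abs_of_nonpos (by omega), abs_of_neg h]
      ring
    · refine ⟨1, ?_⟩
      simp only [Pi.zero_apply, Units.val_one] at h ⊢
      rw [abs_of_nonneg (by omega), abs_of_pos h]
  obtain ⟨ε, hε⟩ := key
  refine ⟨_, single_mem_leeSphere1 i ε, ?_⟩
  rw [← Finset.add_sum_erase _ _ (Finset.mem_univ i),
    ← Finset.add_sum_erase _ (fun i => |x i|) (Finset.mem_univ i)]
  have hrest : ∑ j ∈ Finset.univ.erase i, |(x - (Pi.single i (ε : ℤ) : Fin n → ℤ)) j|
      = ∑ j ∈ Finset.univ.erase i, |x j| := by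
    refine Finset.sum_congr rfl fun j hj => ?_
    simp [Finset.ne_of_mem_erase hj]
  rw [hrest]
  simp [hε]

lemma eq_zero_of_sum_abs_nonpos {x : Fin n → ℤ} (hx : ∑ i, |x i| ≤ 0) : x = 0 := by
  funext i
  have := Finset.single_le_sum (f := fun i => |x i|) (fun i _ => abs_nonneg (x i))
    (Finset.mem_univ i)
  exact abs_nonpos_iff.mp (this.trans hx)

lemma mem_leeSphere1_of_sum_abs_le_one {x : Fin n → ℤ} (hx : ∑ i, |x i| ≤ 1) :
    x ∈ leeSphere1 n := by
  rcases eq_or_ne x 0 with rfl | h0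
  · exact zero_mem_leeSphere1
  · obtain ⟨u, hu, h⟩ := exists_mem_leeSphere1_sum_abs_sub h0
    have : x - u = 0 := eq_zero_of_sum_abs_nonpos (by omega)
    rwa [sub_eq_zero.mp this]

lemma mem_LeeSphere2_iff {x : Fin n → ℤ} :
    x ∈ LeeSphere2 n ↔ ∃ u ∈ leeSphere1 n, ∃ v ∈ leeSphere1 n, x = u + v := by
  constructor
  · intro hx
    rcases eq_or_ne x 0 with rfl | h0
    · exact ⟨0, zero_mem_leeSphere1, 0, zero_mem_leeSphere1, by simp⟩
    · obtain ⟨u, hu, h⟩ := exists_mem_leeSphere1_sum_abs_sub h0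
      have hx' : ∑ i, |x i| ≤ 2 := hx
      exact ⟨u, hu, x - u, mem_leeSphere1_of_sum_abs_le_one (by omega), by abel⟩
  · rintro ⟨u, hu, v, hv, rfl⟩
    have h : ∑ i, |(u + v) i| ≤ ∑ i, |u i| + ∑ i, |v i| := by
      rw [← Finset.sum_add_distrib]
      exact Finset.sum_le_sum fun i _ => abs_add_le _ _
    have := sum_abs_le_one_of_mem hu
    have := sum_abs_le_one_of_mem hv
    change ∑ i, |(u + v) i| ≤ 2
    omega

lemma add_mem_LeeSphere2 {u v : Fin n → ℤ} (hu : u ∈ leeSphere1 n) (hv : v ∈ leeSphere1 n) :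
    u + v ∈ LeeSphere2 n :=
  mem_LeeSphere2_iff.mpr ⟨u, hu, v, hv, rfl⟩

lemma leeSphere1_subset_LeeSphere2 : leeSphere1 n ⊆ LeeSphere2 n := fun u hu => by
  simpa using add_mem_LeeSphere2 hu zero_mem_leeSphere1

lemma dotProduct_nonpos_of_ne {u v : Fin n → ℤ} (hu : u ∈ leeSphere1 n) (hv : v ∈ leeSphere1 n)
    (h : u ≠ v) : u ⬝ᵥ v ≤ 0 := by
  obtain ⟨_ | ⟨i, ε⟩, rfl⟩ := hu
  · simp [leeUnit]
  obtain ⟨_ | ⟨j, δ⟩, rfl⟩ := hv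
  · simp [leeUnit]
  by_cases hij : i = j
  · subst hij
    rcases Int.units_eq_one_or ε with rfl | rfl <;> rcases Int.units_eq_one_or δ with rfl | rfl <;>
      simp_all [leeUnit]
  · simp [leeUnit, hij]

lemma dotProduct_self_pos {u : Fin n → ℤ} (hu : u ≠ 0) : 0 < u ⬝ᵥ u := by
  have h0 : u ⬝ᵥ u ≠ 0 := fun h => hu (dotProduct_self_eq_zero.mp h)
  have h1 : 0 ≤ u ⬝ᵥ u := Finset.sum_nonneg fun i _ => mul_self_nonneg (u i)
  omega

lemma eq_zero_of_add_eq_add {u v w z : Fin n → ℤ} (hu : u ∈ leeSphere1 n)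
    (hv : v ∈ leeSphere1 n) (hw : w ∈ leeSphere1 n) (hz : z ∈ leeSphere1 n)
    (h : u + v = w + z) (h0 : u + v ≠ 0) (huw : u ≠ w) (huz : u ≠ z) : u = 0 := by
  by_contra hu0
  have h1 := dotProduct_self_pos hu0
  have h2 := dotProduct_nonpos_of_ne hu hw huw
  have h3 := dotProduct_nonpos_of_ne hu hz huz
  have h4 := dotProduct_nonpos_of_ne hu (neg_mem_leeSphere1 hv)
    (fun h => h0 (by rw [h]; simp))
  have h5 : u ⬝ᵥ (u + v) = u ⬝ᵥ (w + z) := by rw [h]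
  rw [dotProduct_add, dotProduct_add] at h5
  rw [dotProduct_neg] at h4
  omega

lemma isNonzeroSidon_leeSphere1 : IsNonzeroSidon (leeSphere1 n) := by
  intro u hu v hv w hw z hz h h0
  by_cases huw : u = w
  · subst huw
    exact .inl ⟨rfl, add_left_cancel h⟩
  by_cases huz : u = z
  · subst huz
    exact .inr ⟨rfl, add_left_cancel (h.trans (add_comm _ _))⟩
  have hu0 := eq_zero_of_add_eq_add hu hv hw hz h h0 huw huz
  have hv0 : v = 0 := by
    refine eq_zero_of_add_eq_add hv hu hw hz ((add_comm _ _).trans h) (by rwa [add_comm]) ?_ ?_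
    · rintro rfl
      exact huz (add_right_cancel (h.trans (add_comm _ _)))
    · rintro rfl
      exact huw (add_right_cancel h)
  exact absurd (by simp [hu0, hv0]) h0

end LeeSphere

section Counting

lemma ncard_setOf_eq_sum {α : Type*} [Fintype α] (p : α → Prop) :
    {a | p a}.ncard = ∑ a, if p a then 1 else 0 := by
  rw [Set.ncard_eq_toFinset_card', Set.toFinset_ofPred, Finset.card_filter]

lemma ncard_add_eq {G : Type*} [AddCommGroup G] (S T : Set G) (h : G) :
    {p : G × G | p.1 ∈ S ∧ p.2 ∈ T ∧ p.1 + p.2 = h}.ncard = {a | a ∈ S ∧ h - a ∈ T}.ncard := by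
  refine Set.ncard_congr (fun p _ => p.1) ?_ ?_ ?_
  · rintro ⟨a, b⟩ ⟨ha, hb, rfl⟩
    exact ⟨ha, by simpa using hb⟩
  · rintro ⟨a, b⟩ ⟨c, d⟩ ⟨-, -, h1⟩ ⟨-, -, h2⟩ hac
    obtain rfl : a = c := hac
    exact Prod.ext rfl (add_left_cancel (h1.trans h2.symm))
  · rintro a ⟨ha, hb⟩
    exact ⟨(a, h - a), ⟨ha, hb, by simp⟩, rfl⟩

lemma ncard_sub_mem_comm {G : Type*} [AddCommGroup G] (S T : Set G) (h : G) :
    {a | a ∈ S ∧ h - a ∈ T}.ncard = {a | a ∈ T ∧ h - a ∈ S}.ncard := by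
  refine Set.ncard_congr (fun a _ => h - a) ?_ ?_ ?_
  · rintro a ⟨ha, hb⟩
    exact ⟨hb, by simpa using ha⟩
  · intro a b _ _ hab
    exact sub_right_injective hab
  · rintro a ⟨ha, hb⟩
    exact ⟨h - a, ⟨hb, by simpa using ha⟩, by simp⟩

lemma ncard_prod_zmod_two {A : Type*} [Fintype A] (p : A × ZMod 2 → Prop) :
    {x | p x}.ncard = {a | p (a, 0)}.ncard + {a | p (a, 1)}.ncard := by
  simp only [ncard_setOf_eq_sum, Fintype.sum_prod_type]
  rw [← Finset.sum_add_distrib]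
  exact Finset.sum_congr rfl fun a _ => Fin.sum_univ_two _

lemma rep_zmod_two_zero {A : Type*} [AddCommGroup A] [Fintype A] (T : Set (A × ZMod 2)) (h : A) :
    rep T (h, 0) = rep {a | (a, 0) ∈ T} h + rep {a | (a, 1) ∈ T} h := by
  have e : (-1 : ZMod 2) = 1 := rfl
  have e2 : (2 : ZMod 2) = 0 := rfl
  simp only [rep, ncard_add_eq]
  rw [ncard_prod_zmod_two, ncard_prod_zmod_two]
  simp [e, e2]
  ring

lemma rep_zmod_two_one {A : Type*} [AddCommGroup A] [Fintype A] (T : Set (A × ZMod 2)) (h : A) :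
    rep T (h, 1) =
      2 * {p : A × A | p.1 ∈ {a | (a, (0 : ZMod 2)) ∈ T} ∧ p.2 ∈ {a | (a, (1 : ZMod 2)) ∈ T} ∧
        p.1 + p.2 = h}.ncard := by
  have e2 : (2 : ZMod 2) = 0 := rfl
  simp only [rep, ncard_add_eq]
  rw [ncard_prod_zmod_two, ncard_prod_zmod_two]
  have := ncard_sub_mem_comm {a : A | (a, (1 : ZMod 2)) ∈ T} {a | (a, (0 : ZMod 2)) ∈ T} h
  simp only [Set.mem_ofPred_eq] at this
  simp [e2, this]
  ring

variable {G : Type*} [AddCommGroup G]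

lemma setOf_add_eq_of_sidon {T : Set G} (hT : IsNonzeroSidon T) {a b : G} (ha : a ∈ T) (hb : b ∈ T)
    (h0 : a + b ≠ 0) :
    {p : G × G | p.1 ∈ T ∧ p.2 ∈ T ∧ p.1 + p.2 = a + b} = {(a, b), (b, a)} := by
  ext ⟨c, d⟩
  simp only [Set.mem_ofPred_eq, Set.mem_insert_iff, Set.mem_singleton_iff, Prod.mk.injEq]
  constructor
  · rintro ⟨hc, hd, h⟩
    exact hT c hc d hd a ha b hb h (h ▸ h0)
  · rintro (⟨rfl, rfl⟩ | ⟨rfl, rfl⟩)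
    exacts [⟨ha, hb, rfl⟩, ⟨hb, ha, add_comm _ _⟩]

lemma rep_le_two {T : Set G} (hT : IsNonzeroSidon T) {h : G} (h0 : h ≠ 0) : rep T h ≤ 2 := by
  by_cases hex : ∃ a ∈ T, ∃ b ∈ T, a + b = h
  · obtain ⟨a, ha, b, hb, rfl⟩ := hex
    rw [rep, setOf_add_eq_of_sidon hT ha hb h0]
    have hsq : ∀ t ∈ T, 2 • t = a + b → t = a ∧ t = b := by
      intro t ht h
      rw [two_nsmul] at h
      have := hT t ht t ht a ha b hb h (h ▸ h0)
      tauto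
    by_cases hab : a = b
    · subst hab
      have h1 : {t | t ∈ T ∧ 2 • t = a + a}.ncard ≤ ({a} : Set G).ncard :=
        Set.ncard_le_ncard (fun t ht => (hsq t ht.1 ht.2).1)
      simp at h1 ⊢
      omega
    · have h1 : {t | t ∈ T ∧ 2 • t = a + b} = ∅ :=
        Set.eq_empty_of_forall_notMem fun t ht =>
          hab ((hsq t ht.1 ht.2).1.symm.trans (hsq t ht.1 ht.2).2)
      have h2 := Set.ncard_insert_le (a, b) {(b, a)}
      rw [Set.ncard_singleton] at h2
      rw [h1, Set.ncard_empty]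
      exact h2
  · have h1 : {p : G × G | p.1 ∈ T ∧ p.2 ∈ T ∧ p.1 + p.2 = h} = ∅ :=
      Set.eq_empty_of_forall_notMem fun p hp => hex ⟨p.1, hp.1, p.2, hp.2.1, hp.2.2⟩
    have h2 : {t | t ∈ T ∧ 2 • t = h} = ∅ :=
      Set.eq_empty_of_forall_notMem fun t ht => hex ⟨t, ht.1, t, ht.1, two_nsmul t ▸ ht.2⟩
    simp [rep, h1, h2]

lemma rep_zero {T : Set G} (hneg : ∀ t ∈ T, -t ∈ T) :
    rep T 0 = T.ncard + {t | t ∈ T ∧ 2 • t = 0}.ncard := by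
  rw [rep, ncard_add_eq]
  congr 2
  ext t
  simpa using hneg t

variable [Fintype G]

lemma exists_add_of_rep_ne_zero {T : Set G} {h : G} (hr : rep T h ≠ 0) :
    ∃ a ∈ T, ∃ b ∈ T, a + b = h := by
  by_contra! hne
  refine hr ?_
  have h1 : {p : G × G | p.1 ∈ T ∧ p.2 ∈ T ∧ p.1 + p.2 = h} = ∅ :=
    Set.eq_empty_of_forall_notMem fun p hp => hne p.1 hp.1 p.2 hp.2.1 hp.2.2
  have h2 : {t | t ∈ T ∧ 2 • t = h} = ∅ :=
    Set.eq_empty_of_forall_notMem fun t ht => hne t ht.1 t ht.1 (two_nsmul t ▸ ht.2)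
  simp [rep, h1, h2]

lemma isNonzeroSidon_of_rep_le_two {T : Set G} (hT : ∀ h ≠ 0, rep T h ≤ 2) :
    IsNonzeroSidon T := by
  intro a ha b hb c hc d hd h h0
  by_contra! hne
  have hr := hT _ h0
  rw [rep] at hr
  have hcd : (c, d) ∉ ({(a, b), (b, a)} : Set (G × G)) := by
    simp only [Set.mem_insert_iff, Set.mem_singleton_iff, Prod.mk.injEq]
    rintro (⟨rfl, rfl⟩ | ⟨rfl, rfl⟩)
    exacts [hne.1 rfl rfl, hne.2 rfl rfl]
  have hsub : (insert (c, d) {(a, b), (b, a)} : Set (G × G)).ncard ≤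
      {p : G × G | p.1 ∈ T ∧ p.2 ∈ T ∧ p.1 + p.2 = a + b}.ncard := by
    refine Set.ncard_le_ncard ?_
    rintro _ (rfl | rfl | rfl)
    exacts [⟨hc, hd, h.symm⟩, ⟨ha, hb, rfl⟩, ⟨hb, ha, add_comm _ _⟩]
  rw [Set.ncard_insert_of_notMem hcd] at hsub
  by_cases hab : a = b
  · subst hab
    have hdc : (d, c) ∉ ({(c, d), (a, a)} : Set (G × G)) := by
      simp only [Set.mem_insert_iff, Set.mem_singleton_iff, Prod.mk.injEq]
      rintro (⟨rfl, -⟩ | ⟨rfl, rfl⟩)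
      · have hsub : ({d, a} : Set G).ncard ≤ {t : G | t ∈ T ∧ 2 • t = a + a}.ncard := by
          refine Set.ncard_le_ncard ?_
          rintro _ (rfl | rfl)
          exacts [⟨hd, by rw [two_nsmul, h]⟩, ⟨ha, two_nsmul _⟩]
        rw [Set.ncard_pair (fun h => hne.1 h.symm h.symm)] at hsub
        simp at *
        omega
      · exact hne.1 rfl rfl
    have hsub' : (insert (d, c) {(c, d), (a, a)} : Set (G × G)).ncard ≤
        {p : G × G | p.1 ∈ T ∧ p.2 ∈ T ∧ p.1 + p.2 = a + a}.ncard := by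
      refine Set.ncard_le_ncard ?_
      rintro _ (rfl | rfl | rfl)
      exacts [⟨hd, hc, by rw [h]; exact add_comm _ _⟩, ⟨hc, hd, h.symm⟩, ⟨ha, ha, rfl⟩]
    rw [Set.ncard_insert_of_notMem hdc, Set.ncard_pair (by
      rintro h; exact hcd (by simp [h]))] at hsub'
    omega
  · rw [Set.ncard_pair (by simp [hab])] at hsub
    omega

lemma sum_rep (T : Set G) : ∑ h, rep T h = T.ncard ^ 2 + T.ncard := by
  have hT : T.ncard = ∑ a, if a ∈ T then 1 else 0 := ncard_setOf_eq_sum (· ∈ T)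
  simp only [rep, Finset.sum_add_distrib]
  congr 1
  · simp only [ncard_setOf_eq_sum]
    rw [Finset.sum_comm, hT, sq, Finset.sum_mul_sum, Fintype.sum_prod_type]
    refine Finset.sum_congr rfl fun a _ => Finset.sum_congr rfl fun b _ => ?_
    by_cases ha : a ∈ T <;> by_cases hb : b ∈ T <;> simp [ha, hb]
  · simp only [ncard_setOf_eq_sum]
    rw [Finset.sum_comm, hT]
    refine Finset.sum_congr rfl fun a _ => ?_
    by_cases ha : a ∈ T <;> simp [ha]

end Counting

section Groups

/-- An abelian group of order `2N` with `N` odd splits off its involution. -/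
lemma exists_mulEquiv_prod_zmod_two {G : Type} [CommGroup G] [Finite G] {N : ℕ} (hN : Odd N)
    (hG : Nat.card G = 2 * N) :
    ∃ K : Subgroup G, Nat.card K = N ∧ Nonempty (G ≃* K × Multiplicative (ZMod 2)) := by
  have : Fact (Nat.Prime 2) := ⟨Nat.prime_two⟩
  obtain ⟨f, hf⟩ := exists_prime_orderOf_dvd_card' (G := G) 2 (hG ▸ dvd_mul_right 2 N)
  have hZ : Nat.card (Subgroup.zpowers f) = 2 := by rw [Nat.card_zpowers, hf]
  have hidx : (Subgroup.zpowers f).index = N := by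
    have := (Subgroup.zpowers f).card_mul_index
    rw [hZ, hG] at this
    omega
  obtain ⟨K, hK⟩ := Subgroup.exists_left_complement'_of_coprime (N := Subgroup.zpowers f)
    (by rw [hZ, hidx]; exact Nat.coprime_two_left.mpr hN)
  have hcard : Nat.card K = N := by
    have := hK.card_mul_card
    rw [hZ, hG] at this
    omega
  refine ⟨K, hcard, ⟨?_⟩⟩
  have e₁ : K × Subgroup.zpowers f ≃* G :=
    MulEquiv.ofBijective (K.subtype.coprod (Subgroup.zpowers f).subtype) hK
  have e₂ : Subgroup.zpowers f ≃* Multiplicative (ZMod 2) :=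
    mulEquivOfPrimeCardEq (p := 2) hZ (by simp)
  exact e₁.symm.trans (MulEquiv.prodCongr (MulEquiv.refl K) e₂)

lemma exists_addEquiv_prod_zmod_two {G : Type} [AddCommGroup G] [Finite G] {N : ℕ} (hN : Odd N)
    (hG : Nat.card G = 2 * N) :
    ∃ (A : Type) (_ : AddCommGroup A) (_ : Fintype A),
      Fintype.card A = N ∧ Nonempty (G ≃+ A × ZMod 2) := by
  obtain ⟨K, hK, ⟨e⟩⟩ := exists_mulEquiv_prod_zmod_two (G := Multiplicative G) hN hG
  have : Finite (Additive K) := inferInstanceAs (Finite K)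
  refine ⟨Additive K, inferInstance, Fintype.ofFinite _, ?_, ⟨?_⟩⟩
  · exact (@Nat.card_eq_fintype_card _ (_)).symm.trans hK
  · exact
      { toFun := fun g => (Additive.ofMul (e (Multiplicative.ofAdd g)).1,
          (e (Multiplicative.ofAdd g)).2.toAdd)
        invFun := fun x => (e.symm (x.1.toMul, Multiplicative.ofAdd x.2)).toAdd
        left_inv := fun g => by simp
        right_inv := fun x => by simp
        map_add' := fun g h => by simp }

lemma eq_zero_of_two_nsmul_eq_zero {A : Type*} [AddCommGroup A] [Fintype A]
    (hA : Odd (Fintype.card A)) {a : A} (ha : 2 • a = 0) : a = 0 := by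
  have h1 : addOrderOf a ∣ 2 := addOrderOf_dvd_of_nsmul_eq_zero ha
  have h2 : addOrderOf a ∣ Fintype.card A := addOrderOf_dvd_card
  have h3 := Nat.dvd_gcd h1 h2
  rw [Nat.coprime_two_left.mpr hA] at h3
  exact AddMonoid.addOrderOf_eq_one_iff.mp (Nat.dvd_one.mp h3)

/-- A symmetric set without self-inverse elements splits as `R ∪ -R`. -/
lemma exists_half {G : Type*} [AddCommGroup G] [Finite G] {S : Set G} (hneg : ∀ t ∈ S, -t ∈ S)
    (hne : ∀ t ∈ S, t ≠ -t) :
    ∃ R ⊆ S, 2 * R.ncard = S.ncard ∧ ∀ t ∈ S, t ∈ R ∨ -t ∈ R := by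
  let e := Finite.equivFin G
  let R := {t ∈ S | e t < e (-t)}
  have hR : S = R ∪ Neg.neg '' R := by
    ext t
    constructor
    · intro ht
      rcases lt_or_gt_of_ne (fun h => hne t ht (e.injective h)) with h | h
      · exact .inl ⟨ht, h⟩
      · exact .inr ⟨-t, ⟨hneg t ht, by simpa using h⟩, neg_neg t⟩
    · rintro (h | ⟨s, h, rfl⟩)
      exacts [h.1, hneg s h.1]
  have hdisj : Disjoint R (Neg.neg '' R) := by
    rw [Set.disjoint_left]
    rintro _ h ⟨s, hs, rfl⟩
    have h1 := h.2
    have h2 := hs.2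
    rw [neg_neg] at h1
    exact lt_asymm h1 h2
  refine ⟨R, fun t ht => ht.1, ?_, fun t ht => ?_⟩
  · rw [hR, Set.ncard_union_eq hdisj, Set.ncard_image_of_injective _ neg_injective, two_mul]
  · rw [hR] at ht
    rcases ht with h | ⟨s, hs, rfl⟩
    exacts [.inl h, .inr (by simpa using hs)]

end Groups

section Codes

variable {n : ℕ}

/-- The equation `T² + T⁽²⁾ = 2G + 2n·e - 2f` in the group ring of `G = A × ℤ/2`, written
additively, where `f = (0, 1)`. -/
def RepEqs {A : Type*} [AddCommGroup A] (n : ℕ) (T : Set (A × ZMod 2)) : Prop :=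
  ∀ g, rep T g + (if g = (0, 1) then 2 else 0) = 2 + if g = 0 then 2 * n else 0

lemma repEqs_iff {A : Type*} [AddCommGroup A] [Fintype A] (T : Set (A × ZMod 2)) :
    RepEqs n T ↔
      APLLEqs (H := Multiplicative A) n {a | (a.toAdd, 0) ∈ T} {a | (a.toAdd, 1) ∈ T} := by
  have key : RepEqs n T ↔
      (∀ h : A, rep T (h, 1) = 2 * if h = 0 then 0 else 1) ∧
      ∀ h : A, rep T (h, 0) = 2 + if h = 0 then 2 * n else 0 := by
    constructor
    · intro hT
      refine ⟨fun h => ?_, fun h => ?_⟩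
      · have := hT (h, 1)
        by_cases h0 : h = 0
        · simpa [h0] using this
        · simpa [h0] using this
      · simpa using hT (h, 0)
    · rintro ⟨h1, h0⟩ ⟨h, i⟩
      obtain rfl | rfl : i = 0 ∨ i = 1 := by revert i; decide
      · simpa using h0 h
      · rw [h1]
        simp only [Prod.mk.injEq, and_true, Prod.mk_eq_zero, one_ne_zero, and_false]
        split_ifs <;> simp_all
  rw [key]
  refine and_congr (forall_congr' fun h => ?_) (forall_congr' fun h => ?_)
  · rw [rep_zmod_two_one]
    exact Nat.mul_right_inj two_ne_zero
  · rw [rep_zmod_two_zero, rep, rep]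
    refine Eq.congr ?_ rfl
    rw [add_add_add_comm, ← add_assoc]
    rfl

lemma injOn_LeeSphere2_of_isNonzeroSidon {G : Type*} [AddCommGroup G] (φ : (Fin n → ℤ) →+ G)
    (hφ : Set.InjOn φ (leeSphere1 n)) (hS : IsNonzeroSidon (φ '' leeSphere1 n)) :
    Set.InjOn φ (LeeSphere2 n) := by
  intro x hx y hy hxy
  obtain ⟨u, hu, v, hv, rfl⟩ := mem_LeeSphere2_iff.mp hx
  obtain ⟨w, hw, z, hz, rfl⟩ := mem_LeeSphere2_iff.mp hy
  have zero_of : ∀ u ∈ leeSphere1 n, ∀ v ∈ leeSphere1 n, φ (u + v) = 0 → u + v = 0 := by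
    intro u hu v hv h
    rw [map_add, add_eq_zero_iff_eq_neg, ← map_neg] at h
    rw [hφ hu (neg_mem_leeSphere1 hv) h, neg_add_cancel]
  by_cases h0 : φ (u + v) = 0
  · rw [zero_of u hu v hv h0, zero_of w hw z hz (hxy ▸ h0)]
  · rw [map_add] at h0
    rw [map_add, map_add] at hxy
    rcases hS _ ⟨u, hu, rfl⟩ _ ⟨v, hv, rfl⟩ _ ⟨w, hw, rfl⟩ _ ⟨z, hz, rfl⟩ hxy h0 with h | h
    · rw [hφ hu hw h.1, hφ hv hz h.2]
    · rw [hφ hu hz h.1, hφ hv hw h.2, add_comm]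

lemma isNonzeroSidon_image {G : Type*} [AddCommGroup G] (φ : (Fin n → ℤ) →+ G)
    (hφ : Set.InjOn φ (LeeSphere2 n)) : IsNonzeroSidon (φ '' leeSphere1 n) := by
  rintro _ ⟨u, hu, rfl⟩ _ ⟨v, hv, rfl⟩ _ ⟨w, hw, rfl⟩ _ ⟨z, hz, rfl⟩ h h0
  rw [← map_add, ← map_add] at h
  have := hφ (add_mem_LeeSphere2 hu hv) (add_mem_LeeSphere2 hw hz) h
  have h0' : u + v ≠ 0 := fun h => h0 (by rw [← map_add, h, map_zero])
  rcases isNonzeroSidon_leeSphere1 u hu v hv w hw z hz this h0' with ⟨rfl, rfl⟩ | ⟨rfl, rfl⟩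
  exacts [.inl ⟨rfl, rfl⟩, .inr ⟨rfl, rfl⟩]

lemma disjoint_translates_iff {G : Type*} [AddCommGroup G] (φ : (Fin n → ℤ) →+ G) :
    (∀ c₁ ∈ φ.ker, ∀ c₂ ∈ φ.ker, c₁ ≠ c₂ →
      Disjoint ((fun x => x + c₁) '' LeeSphere2 n) ((fun x => x + c₂) '' LeeSphere2 n)) ↔
      Set.InjOn φ (LeeSphere2 n) := by
  constructor
  · intro h x hx y hy hxy
    by_contra hne
    have hc : y - x ∈ φ.ker := by simp [AddMonoidHom.mem_ker, hxy]
    refine Set.disjoint_left.mp (h (y - x) hc 0 (zero_mem _) (sub_ne_zero.mpr (Ne.symm hne)))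
      ⟨x, hx, rfl⟩ ⟨y, hy, ?_⟩
    simp
  · intro h c₁ hc₁ c₂ hc₂ hne
    rw [Set.disjoint_left]
    rintro _ ⟨x, hx, rfl⟩ ⟨y, hy, hxy⟩
    have hxy' : y + c₂ = x + c₁ := hxy
    have := congrArg φ hxy'
    rw [map_add, map_add, AddMonoidHom.mem_ker.mp hc₁, AddMonoidHom.mem_ker.mp hc₂, add_zero,
      add_zero] at this
    obtain rfl := h hy hx this
    exact hne (add_left_cancel hxy').symm

lemma odd_sq_add_self_add_one (n : ℕ) : Odd (n ^ 2 + n + 1) := by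
  have := Nat.even_mul_succ_self n
  rw [show n ^ 2 + n = n * (n + 1) by ring]
  exact this.add_one

section

variable {A : Type} [AddCommGroup A] [Fintype A]

lemma eq_zero_or_eq_of_two_nsmul (hA : Odd (Fintype.card A)) {g : A × ZMod 2} (hg : 2 • g = 0) :
    g = 0 ∨ g = (0, 1) := by
  obtain ⟨a, i⟩ := g
  have ha : a = 0 := eq_zero_of_two_nsmul_eq_zero hA (congrArg Prod.fst hg)
  obtain rfl | rfl : i = 0 ∨ i = 1 := by clear hg; revert i; decide
  exacts [.inl (by simp [ha]), .inr (by simp [ha])]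

lemma repEqs_image (hA : Fintype.card A = n ^ 2 + n + 1) (φ : (Fin n → ℤ) →+ A × ZMod 2)
    (hφ : Set.InjOn φ (LeeSphere2 n)) : RepEqs n (φ '' leeSphere1 n) := by
  set T := φ '' leeSphere1 n with hT
  have hinj : Set.InjOn φ (leeSphere1 n) := hφ.mono leeSphere1_subset_LeeSphere2
  have hcard : T.ncard = 2 * n + 1 := by rw [hT, hinj.ncard_image, ncard_leeSphere1]
  have hsidon : IsNonzeroSidon T := isNonzeroSidon_image φ hφ
  have hneg : ∀ t ∈ T, -t ∈ T := by
    rintro _ ⟨u, hu, rfl⟩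
    exact ⟨-u, neg_mem_leeSphere1 hu, map_neg φ u⟩
  have hself : ∀ t ∈ T, t = -t → t = 0 := by
    rintro _ ⟨u, hu, rfl⟩ h
    rw [← map_neg] at h
    rw [self_eq_neg.mp (hinj hu (neg_mem_leeSphere1 hu) h), map_zero]
  have h0T : (0 : A × ZMod 2) ∈ T := ⟨0, zero_mem_leeSphere1, map_zero φ⟩
  have hrep0 : rep T 0 = 2 * n + 2 := by
    have : {t | t ∈ T ∧ 2 • t = 0} = {0} := by
      ext t
      constructor
      · rintro ⟨ht, h⟩
        rw [two_nsmul] at h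
        exact hself t ht (eq_neg_of_add_eq_zero_left h)
      · rintro rfl
        exact ⟨h0T, nsmul_zero 2⟩
    rw [rep_zero hneg, this, hcard, Set.ncard_singleton]
  have hf0 : ((0, 1) : A × ZMod 2) ≠ 0 := by simp
  have hfneg : -((0, 1) : A × ZMod 2) = (0, 1) := by
    ext <;> simp
  have hrepf : rep T (0, 1) = 0 := by
    by_contra hne
    obtain ⟨a, ha, b, hb, hab⟩ := exists_add_of_rep_ne_zero hne
    have h : a + b = -a + -b := by rw [← neg_add, hab, hfneg]
    rcases hsidon a ha b hb _ (hneg a ha) _ (hneg b hb) h (hab ▸ hf0) with h | h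
    · rw [hself a ha h.1, hself b hb h.2, add_zero] at hab
      exact hf0 hab.symm
    · rw [h.1, neg_add_cancel] at hab
      exact hf0 hab.symm
  have hcardG : Fintype.card (A × ZMod 2) = 2 * n ^ 2 + 2 * n + 2 := by
    rw [Fintype.card_prod, hA, ZMod.card]
    ring
  have hle : ∀ g ∈ Finset.univ,
      rep T g + (if g = (0, 1) then 2 else 0) ≤ 2 + if g = 0 then 2 * n else 0 := by
    intro g _
    by_cases hg : g = 0
    · subst hg
      simp [hrep0, hf0.symm, add_comm]
    by_cases hgf : g = (0, 1)
    · subst hgf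
      simp [hrepf]
    simpa [hg, hgf] using rep_le_two hsidon hg
  have hsum : ∑ g : A × ZMod 2, (rep T g + (if g = (0, 1) then 2 else 0)) =
      ∑ g : A × ZMod 2, (2 + if g = 0 then 2 * n else 0) := by
    rw [Finset.sum_add_distrib, Finset.sum_add_distrib, sum_rep, hcard]
    simp only [Finset.sum_ite_eq', Finset.mem_univ, if_true, Finset.sum_const, Finset.card_univ,
      hcardG, smul_eq_mul]
    ring
  exact fun g => (Finset.sum_eq_sum_iff_of_le hle).mp hsum g (Finset.mem_univ g)

lemma exists_hom_of_half {G : Type*} [AddCommGroup G] [Finite G] {R T : Set G}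
    (hR : R.ncard = n) (hRT : R ⊆ T) (hneg : ∀ t ∈ T, -t ∈ T) (h0 : (0 : G) ∈ T)
    (hT : ∀ t ∈ T, t ≠ 0 → t ∈ R ∨ -t ∈ R) :
    ∃ φ : (Fin n → ℤ) →+ G, φ '' leeSphere1 n = T := by
  let a : Fin n ≃ R := (Finite.equivFinOfCardEq hR).symm
  let φ : (Fin n → ℤ) →+ G :=
    ∑ i, (zmultiplesHom G (a i : G)).comp (Pi.evalAddMonoidHom (fun _ => ℤ) i)
  have hφ : ∀ i (ε : ℤ), φ (Pi.single i ε) = ε • (a i : G) := by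
    intro i ε
    simp only [φ, AddMonoidHom.finsetSum_apply, AddMonoidHom.comp_apply,
      Pi.evalAddMonoidHom_apply, zmultiplesHom_apply]
    rw [Finset.sum_eq_single i] <;> simp +contextual
  refine ⟨φ, Set.Subset.antisymm ?_ ?_⟩
  · rintro _ ⟨_, ⟨_ | ⟨i, ε⟩, rfl⟩, rfl⟩
    · simpa [leeUnit] using h0
    · have hi := hRT (a i).2
      simp only [leeUnit, hφ]
      rcases Int.units_eq_one_or ε with rfl | rfl
      · simpa using hi
      · simpa using hneg _ hi
  · intro t ht
    by_cases ht0 : t = 0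
    · exact ⟨0, zero_mem_leeSphere1, by simp [ht0]⟩
    rcases hT t ht ht0 with h | h
    · refine ⟨_, single_mem_leeSphere1 (a.symm ⟨t, h⟩) 1, ?_⟩
      rw [hφ]
      simp
    · refine ⟨_, single_mem_leeSphere1 (a.symm ⟨-t, h⟩) (-1), ?_⟩
      rw [hφ]
      simp

lemma exists_hom_of_repEqs (hn : 0 < n) (hA : Fintype.card A = n ^ 2 + n + 1)
    {T : Set (A × ZMod 2)} (hneg : ∀ t ∈ T, -t ∈ T) (h0T : 0 ∈ T) (hT : RepEqs n T) :
    ∃ φ : (Fin n → ℤ) →+ A × ZMod 2, Function.Surjective φ ∧ Set.InjOn φ (LeeSphere2 n) := by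
  have hodd : Odd (Fintype.card A) := hA ▸ odd_sq_add_self_add_one n
  have hf0 : ((0, 1) : A × ZMod 2) ≠ 0 := by simp
  have hfT : ((0, 1) : A × ZMod 2) ∉ T := by
    intro hf
    have h1 : rep T (0, 1) = 0 := by simpa using hT (0, 1)
    have h2 : {p : (A × ZMod 2) × (A × ZMod 2) | p.1 ∈ T ∧ p.2 ∈ T ∧ p.1 + p.2 = (0, 1)} = ∅ :=
      (Set.ncard_eq_zero).mp (Nat.eq_zero_of_add_eq_zero_right h1)
    have h3 : ((0, (0, 1)) : (A × ZMod 2) × (A × ZMod 2)) ∈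
        {p : (A × ZMod 2) × (A × ZMod 2) | p.1 ∈ T ∧ p.2 ∈ T ∧ p.1 + p.2 = (0, 1)} :=
      ⟨h0T, hf, zero_add _⟩
    rw [h2] at h3
    exact h3
  have htwo : ∀ t ∈ T, 2 • t = 0 → t = 0 := fun t ht h =>
    (eq_zero_or_eq_of_two_nsmul hodd h).resolve_right (by rintro rfl; exact hfT ht)
  have hcard : T.ncard = 2 * n + 1 := by
    have h1 : rep T 0 = 2 + 2 * n := by simpa [hf0.symm] using hT 0
    have h2 : {t | t ∈ T ∧ 2 • t = 0} = {0} := by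
      ext t
      constructor
      · rintro ⟨ht, h⟩
        exact htwo t ht h
      · rintro rfl
        exact ⟨h0T, nsmul_zero 2⟩
    rw [rep_zero hneg, h2, Set.ncard_singleton] at h1
    omega
  obtain ⟨R, hRS, hRcard, hR⟩ := exists_half (S := T \ {0})
    (fun t ht => ⟨hneg t ht.1, by simpa using ht.2⟩)
    (fun t ht h => ht.2 (htwo t ht.1 (by rw [two_nsmul]; exact add_eq_zero_iff_eq_neg.mpr h)))
  rw [Set.ncard_sdiff_singleton_of_mem h0T, hcard] at hRcard
  obtain ⟨φ, hφ⟩ := exists_hom_of_half (n := n) (by omega) (hRS.trans Set.sdiff_subset) hneg h0T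
    (fun t ht h => hR t ⟨ht, h⟩)
  have hsidon : IsNonzeroSidon T := isNonzeroSidon_of_rep_le_two fun h h0 => by
    have := hT h
    rw [if_neg h0] at this
    omega
  refine ⟨φ, ?_, ?_⟩
  · have hrange : ∀ g ≠ ((0, 1) : A × ZMod 2), g ∈ φ.range := by
      intro g hg
      have := hT g
      rw [if_neg hg] at this
      obtain ⟨a, ha, b, hb, rfl⟩ := exists_add_of_rep_ne_zero (T := T) (h := g) (by omega)
      rw [← hφ] at ha hb
      obtain ⟨u, -, rfl⟩ := ha
      obtain ⟨v, -, rfl⟩ := hb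
      exact ⟨u + v, map_add φ u v⟩
    intro g
    by_cases hg : g = (0, 1)
    · have : Nontrivial A := Fintype.one_lt_card_iff_nontrivial.mp (by rw [hA]; omega)
      obtain ⟨a, ha⟩ := exists_ne (0 : A)
      have h := add_mem (hrange (a, 0) (by simp)) (hrange (-a, 1) (by simpa using ha))
      rw [hg]
      simpa using h
    · exact hrange g hg
  · refine injOn_LeeSphere2_of_isNonzeroSidon φ (Set.injOn_of_ncard_image_eq ?_ ?_) (hφ ▸ hsidon)
    · rw [hφ, hcard, ncard_leeSphere1]
    · exact Set.finite_range _

end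

lemma exists_code_iff_exists_hom (n : ℕ) :
    (∃ C : AddSubgroup (Fin n → ℤ), IsAPLLCode n C) ↔
      ∃ (A : Type) (_ : AddCommGroup A) (_ : Fintype A) (φ : (Fin n → ℤ) →+ A × ZMod 2),
        Fintype.card A = n ^ 2 + n + 1 ∧ Function.Surjective φ ∧ Set.InjOn φ (LeeSphere2 n) := by
  constructor
  · rintro ⟨C, hC, hdisj⟩
    have hcard : Nat.card ((Fin n → ℤ) ⧸ C) = 2 * (n ^ 2 + n + 1) := by
      rw [← AddSubgroup.index_eq_card, hC]
      ring
    have : Finite ((Fin n → ℤ) ⧸ C) := Nat.finite_of_card_ne_zero (by rw [hcard]; positivity)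
    obtain ⟨A, _, _, hA, ⟨e⟩⟩ := exists_addEquiv_prod_zmod_two (odd_sq_add_self_add_one n) hcard
    let φ := e.toAddMonoidHom.comp (QuotientAddGroup.mk' C)
    have hker : φ.ker = C := by
      ext x
      simp [φ]
    refine ⟨A, inferInstance, inferInstance, φ, hA,
      e.surjective.comp (QuotientAddGroup.mk'_surjective C), ?_⟩
    rw [← disjoint_translates_iff, hker]
    exact hdisj
  · rintro ⟨A, _, _, φ, hA, hsurj, hinj⟩
    refine ⟨φ.ker, ?_, (disjoint_translates_iff φ).mpr hinj⟩
    rw [AddSubgroup.index_ker, AddMonoidHom.range_eq_top.mpr hsurj, AddSubgroup.card_top,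
      Nat.card_eq_fintype_card, Fintype.card_prod, hA, ZMod.card]
    ring

end Codes

/-- An almost perfect linear Lee code of packing radius 2 exists in `ℤⁿ` iff there
exist a finite abelian group `H` of order `n²+n+1` and two inverse-closed subsets
`T₀, T₁ ⊆ H` with `e ∈ T₀` satisfying the APLL group-ring equations. -/
theorem APLL_code_iff_group_ring (n : ℕ) (hn : 0 < n) :
    (∃ C : AddSubgroup (Fin n → ℤ), IsAPLLCode n C) ↔
      ∃ (H : Type) (i₁ : CommGroup H) (i₂ : Fintype H),
        @GroupRingExistence n H i₁ i₂ := by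
  rw [exists_code_iff_exists_hom]
  constructor
  · rintro ⟨A, _, _, φ, hA, -, hinj⟩
    have hT := (repEqs_iff _).mp (repEqs_image hA φ hinj)
    have hneg : ∀ t, t ∈ φ '' leeSphere1 n → -t ∈ φ '' leeSphere1 n := by
      rintro _ ⟨u, hu, rfl⟩
      exact ⟨-u, neg_mem_leeSphere1 hu, map_neg φ u⟩
    have hinv : ∀ i : ZMod 2, {a : Multiplicative A | (a.toAdd, i) ∈ φ '' leeSphere1 n}⁻¹ =
        {a : Multiplicative A | (a.toAdd, i) ∈ φ '' leeSphere1 n} := by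
      intro i
      ext a
      have hi : -i = i := by revert i; decide
      refine ⟨fun h => ?_, fun h => ?_⟩
      · simpa [hi] using hneg _ h
      · simpa [hi] using hneg _ h
    exact ⟨Multiplicative A, inferInstance, inferInstance,
      (Fintype.card_multiplicative A).trans hA, _, _, hinv 0, hinv 1,
      ⟨0, zero_mem_leeSphere1, map_zero φ⟩, hT⟩
  · rintro ⟨H, _, _, hH', T₀, T₁, hT₀, hT₁, h1, hT⟩
    have hH := (Fintype.card_additive H).trans hH'
    let T : Set (Additive H × ZMod 2) :=
      {x | (x.2 = 0 ∧ x.1.toMul ∈ T₀) ∨ (x.2 = 1 ∧ x.1.toMul ∈ T₁)}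
    have hrep : RepEqs n T := by
      rw [repEqs_iff]
      have e₀ : {a : Multiplicative (Additive H) | (a.toAdd, 0) ∈ T} = T₀ := by
        ext a
        exact ⟨fun h => h.elim (·.2) (fun h => absurd h.1 (by simp)), fun h => .inl ⟨rfl, h⟩⟩
      have e₁ : {a : Multiplicative (Additive H) | (a.toAdd, 1) ∈ T} = T₁ := by
        ext a
        exact ⟨fun h => h.elim (fun h => absurd h.1 (by simp)) (·.2), fun h => .inr ⟨rfl, h⟩⟩
      rw [e₀, e₁]
      exact hT
    have hneg : ∀ t ∈ T, -t ∈ T := by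
      rintro ⟨a, i⟩ (⟨hi, ha⟩ | ⟨hi, ha⟩)
      · exact .inl ⟨by simpa using hi, by rw [← hT₀]; simpa using ha⟩
      · exact .inr ⟨by simp_all, by rw [← hT₁]; simpa using ha⟩
    obtain ⟨φ, hsurj, hinj⟩ :=
      exists_hom_of_repEqs (A := Additive H) hn hH hneg (.inl ⟨rfl, h1⟩) hrep
    exact ⟨Additive H, inferInstance, inferInstance, φ, hH, hsurj, hinj⟩
end

section
/- Let n be a positive integer with n ≡ 1 (mod 6), H a finite abelian group of order n²+n+1, and T₀, T₁ inverse-closed subsets of H with e ∈ T₀ and |T₀| + |T₁| = 2n+1 satisfying the APLL group-ring equations. Then 3|X₀| = (n−1)², |X₁| = n+2, |X₂| = 2n−2, 3|X₃| = 2(n−1)², and |X_i| = 0 for every i > 3. -/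
open scoped Classical Pointwise

open MonoidAlgebra Finset

/-- If the first two moments of `c : α → ℕ` are extremal with respect to the residues of `c` modulo
`3`, then all values of `c` are at most `3`, and the sizes of its level sets are determined. -/
theorem card_filter_eq_of_moments {α : Type*} [Fintype α] {n : ℕ} (c : α → ℕ) (A B : Finset α)
    (φ : α → α) {e : α} (heA : e ∈ A) (hφ : φ e = e) (hAB : Disjoint A B) (hA : #A = n)
    (hB : #B = n + 1) (hcard : Fintype.card α = n ^ 2 + n + 1)
    (hsum : ∑ g, (c g : ℤ) = n * (2 * n + 1)) (hsq : ∑ g, (c g : ℤ) ^ 2 ≤ 6 * n ^ 2 - 3 * n)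
    (hmod : ∀ g, (c g + #{t ∈ A | φ t = g}) % 3
      = ((if g ∈ B then 1 else 0) + 2 * (if g ∈ A then 1 else 0)) % 3) :
    3 * (#{g | c g = 0} : ℤ) = (n - 1) ^ 2 ∧ (#{g | c g = 1} : ℤ) = n + 2 ∧
      (#{g | c g = 2} : ℤ) = 2 * n - 2 ∧ 3 * (#{g | c g = 3} : ℤ) = 2 * (n - 1) ^ 2 ∧
      ∀ g, c g ≤ 3 := by
  set C := A.image φ with hC
  set S := (A ∪ B) ∪ (C \ (A ∪ B)) with hS
  have heC : e ∈ C := Finset.mem_image.2 ⟨e, heA, hφ⟩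
  have hCA : #C ≤ n := hA ▸ Finset.card_image_le
  have hsub : C \ (A ∪ B) ⊆ C.erase e := fun g hg => by grind
  have hCe : #(C.erase e) + 1 = #C := Finset.card_erase_add_one heC
  have hS_card : #S = 2 * n + 1 + #(C \ (A ∪ B)) := by
    rw [hS, Finset.card_union_of_disjoint Finset.disjoint_sdiff,
      Finset.card_union_of_disjoint hAB, hA, hB]
    omega
  have hdiff := Finset.card_le_card hsub
  have hnotS (g : α) (hg : g ∉ S) : c g % 3 = 0 := by
    have h0 : #{t ∈ A | φ t = g} = 0 := by
      rw [Finset.card_eq_zero, Finset.filter_eq_empty_iff]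
      intro t ht htg
      have : g ∈ C := Finset.mem_image.2 ⟨t, ht, htg⟩
      grind
    have h1 : g ∉ A := by grind
    have h2 : g ∉ B := by grind
    simpa [h0, h1, h2] using hmod g
  have hpt (g : α) : 0 ≤ (if g ∈ S then (2 : ℤ) else 0) - (3 * c g - c g ^ 2) := by
    split_ifs with hg
    · rcases le_or_gt (c g) 1 with h | h
      · interval_cases c g <;> simp
      · zify at h
        nlinarith
    · have := hnotS g hg
      rcases le_or_gt (c g) 2 with h | h
      · have : c g = 0 := by omega
        simp [this]
      · zify at h
        nlinarith
  have htot : ∑ g, ((if g ∈ S then (2 : ℤ) else 0) - (3 * c g - c g ^ 2))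
      = 2 * #S - 3 * (n * (2 * n + 1)) + ∑ g, (c g : ℤ) ^ 2 := by
    rw [Finset.sum_sub_distrib, Finset.sum_sub_distrib, ← Finset.mul_sum, hsum,
      ← Finset.sum_filter, Finset.sum_const, Finset.filter_mem_eq_inter, Finset.univ_inter,
      nsmul_eq_mul]
    ring
  have hnonneg := Finset.sum_nonneg fun g (_ : g ∈ Finset.univ) => hpt g
  have hSle : #S ≤ 3 * n := by omega
  have hzero : ∑ g, ((if g ∈ S then (2 : ℤ) else 0) - (3 * c g - c g ^ 2)) = 0 := by
    zify at hSle
    linarith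
  have hScard : #S = 3 * n := by
    zify at hSle ⊢
    linarith
  have hpt0 (g : α) := (Finset.sum_eq_zero_iff_of_nonneg fun g _ => hpt g).1 hzero g (by simp)
  have hC_eq : C \ (A ∪ B) = C.erase e := Finset.eq_of_subset_of_card_le hsub (by omega)
  have hinj : Set.InjOn φ A := Finset.card_image_iff.1 (show #C = #A by omega)
  have hfib (g : α) : #{t ∈ A | φ t = g} = if g ∈ C then 1 else 0 := by
    split_ifs with hg
    · obtain ⟨t, ht, rfl⟩ := Finset.mem_image.1 hg
      rw [Finset.card_eq_one]
      refine ⟨t, ?_⟩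
      ext s
      simp only [Finset.mem_filter, Finset.mem_singleton]
      exact ⟨fun h => hinj h.1 ht h.2, by rintro rfl; exact ⟨ht, rfl⟩⟩
    · rw [Finset.card_eq_zero, Finset.filter_eq_empty_iff]
      exact fun t ht htg => hg (Finset.mem_image.2 ⟨t, ht, htg⟩)
  have hin (g : α) (hg : g ∈ S) : c g = 1 ∨ c g = 2 := by
    have h := hpt0 g
    rw [if_pos hg] at h
    have : ((c g : ℤ) - 1) * (c g - 2) = 0 := by linarith
    rcases mul_eq_zero.1 this with h | h <;> omega
  have hout (g : α) (hg : g ∉ S) : c g = 0 ∨ c g = 3 := by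
    have h := hpt0 g
    rw [if_neg hg] at h
    have : (c g : ℤ) * (c g - 3) = 0 := by linarith
    rcases mul_eq_zero.1 this with h | h <;> omega
  have hle (g : α) : c g ≤ 3 := by
    by_cases hg : g ∈ S
    · have := hin g hg; omega
    · have := hout g hg; omega
  have heB : e ∉ B := Finset.disjoint_left.1 hAB heA
  have hlevel_one : ({g | c g = 1} : Finset α) = insert e B := by
    ext g
    have hm := hmod g
    have hCg : g ∈ C ∧ g ∉ A ∪ B ↔ g ∈ C ∧ g ≠ e := by
      rw [← Finset.mem_sdiff, hC_eq, Finset.mem_erase, and_comm]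
    have hABg : g ∈ A → g ∉ B := fun h => Finset.disjoint_left.1 hAB h
    rw [hfib] at hm
    by_cases hg : g ∈ S
    · have := hin g hg
      simp only [Finset.mem_filter, Finset.mem_univ, true_and, Finset.mem_insert]
      grind
    · have := hout g hg
      simp only [Finset.mem_filter, Finset.mem_univ, true_and, Finset.mem_insert]
      grind
  have h1 : #{g | c g = 1} = n + 2 := by
    rw [hlevel_one, Finset.card_insert_of_notMem heB, hB]
  have hlevel_two : ({g | c g = 2} : Finset α) = S \ ({g | c g = 1} : Finset α) := by
    ext g
    simp only [Finset.mem_filter, Finset.mem_univ, true_and, Finset.mem_sdiff]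
    by_cases hg : g ∈ S
    · have := hin g hg
      grind
    · have := hout g hg
      grind
  have hone_sub : ({g | c g = 1} : Finset α) ⊆ S := fun g hg => by
    by_contra hgS
    have := hout g hgS
    have := (Finset.mem_filter.1 hg).2
    omega
  have h2 : #{g | c g = 2} + (n + 2) = 3 * n := by
    rw [hlevel_two, ← h1, ← hScard]
    exact Finset.card_sdiff_add_card_eq_card hone_sub
  have hmaps : ∀ g ∈ (Finset.univ : Finset α), c g ∈ Finset.range 4 := fun g _ =>
    Finset.mem_range.2 (Nat.lt_succ_of_le (hle g))
  have hcount := Finset.card_eq_sum_card_fiberwise hmaps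
  have hmoment := Finset.sum_fiberwise_of_maps_to hmaps fun g => (c g : ℤ)
  have hfiber (i : ℕ) : ∑ g with c g = i, (c g : ℤ) = #{g | c g = i} * i := by
    rw [Finset.sum_congr rfl fun g hg => by rw [(Finset.mem_filter.1 hg).2], Finset.sum_const,
      nsmul_eq_mul]
  rw [hsum] at hmoment
  rw [Finset.card_univ, hcard] at hcount
  simp only [hfiber, Finset.sum_range_succ, Finset.sum_range_zero] at hcount hmoment
  push_cast at hmoment
  replace hcount := congrArg (Nat.cast (R := ℤ)) hcount
  replace h1 := congrArg (Nat.cast (R := ℤ)) h1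
  replace h2 := congrArg (Nat.cast (R := ℤ)) h2
  simp only [Nat.cast_add, Nat.cast_mul, Nat.cast_pow, Nat.cast_one, Nat.cast_zero,
    Nat.cast_ofNat] at hcount h1 h2
  refine ⟨?_, h1, ?_, ?_, hle⟩ <;> linarith

theorem odd_card {α : Type*} [Fintype α] {n : ℕ} (hcard : Fintype.card α = n ^ 2 + n + 1) :
    Odd (Nat.card α) := by
  rw [Nat.card_eq_fintype_card, hcard, sq, ← Nat.mul_succ]
  exact (Nat.even_mul_succ_self n).add_one

section

variable {H : Type*} [CommGroup H] [Fintype H]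

/-- The element `T⁽ᵏ⁾ = ∑_{t ∈ T} tᵏ` of the group ring `R[H]`. -/
noncomputable def powerSum (R : Type*) [CommRing R] (k : ℕ) (T : Set H) : MonoidAlgebra R H :=
  ∑ t ∈ T.toFinset, single (t ^ k) 1

section GroupRing

variable (R : Type*) [CommRing R]

theorem coeff_powerSum (k : ℕ) (T : Set H) (h : H) :
    (powerSum R k T).coeff h = ({t : H | t ∈ T ∧ t ^ k = h}.ncard : R) := by
  rw [powerSum, coeff_sum, Finsupp.finsetSum_apply, Set.ncard_eq_toFinset_card']
  simp only [coeff_single, Finsupp.single_apply, Finset.sum_boole]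
  congr 2
  ext t
  simp

theorem coeff_powerSum_mul (k l : ℕ) (S T : Set H) (h : H) :
    (powerSum R k S * powerSum R l T).coeff h
      = ({p : H × H | p.1 ∈ S ∧ p.2 ∈ T ∧ p.1 ^ k * p.2 ^ l = h}.ncard : R) := by
  rw [powerSum, powerSum, Finset.sum_mul_sum, ← Finset.sum_product', coeff_sum,
    Finsupp.finsetSum_apply, Set.ncard_eq_toFinset_card']
  simp only [single_mul_single, mul_one, coeff_single, Finsupp.single_apply, Finset.sum_boole]
  congr 2
  ext p
  simp [and_assoc]

theorem coeff_powerSum_univ (h : H) : (powerSum R 1 (Set.univ : Set H)).coeff h = 1 := by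
  simp [coeff_powerSum]

theorem powerSum_mul_univ (k : ℕ) (T : Set H) :
    powerSum R k T * powerSum R 1 (Set.univ : Set H)
      = (T.ncard : MonoidAlgebra R H) * powerSum R 1 (Set.univ : Set H) := by
  have key (g : H) : single g (1 : R) * powerSum R 1 (Set.univ : Set H)
      = powerSum R 1 (Set.univ : Set H) := by
    ext h
    rw [coeff_single_mul_apply, coeff_powerSum_univ, coeff_powerSum_univ, mul_one]
  rw [powerSum, Finset.sum_mul, Finset.sum_congr rfl fun t _ => key (t ^ k), Finset.sum_const,
    nsmul_eq_mul, Set.ncard_eq_toFinset_card']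

theorem powerSum_union (k : ℕ) {S T : Set H} (hST : Disjoint S T) :
    powerSum R k (S ∪ T) = powerSum R k S + powerSum R k T := by
  rw [powerSum, Set.toFinset_union, Finset.sum_union (by simpa using hST), powerSum, powerSum]

theorem mapDomainRingHom_powerSum (j k : ℕ) (T : Set H) :
    mapDomainRingHom R (powMonoidHom j) (powerSum R k T) = powerSum R (k * j) T := by
  simp [powerSum, map_sum, mapDomain_single, pow_mul]

theorem powerSum_two_univ (hodd : (Nat.card H).Coprime 2) :
    powerSum R 2 (Set.univ : Set H) = powerSum R 1 (Set.univ : Set H) := by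
  simp only [powerSum, Set.toFinset_univ, pow_one]
  exact Fintype.sum_equiv (powCoprime hodd) _ _ fun _ => rfl

theorem powerSum_one_pow_char (p : ℕ) [Fact p.Prime] [CharP R p] (T : Set H) :
    powerSum R 1 T ^ p = powerSum R p T := by
  have : CharP (MonoidAlgebra R H) p := by
    refine charP_of_injective_ringHom (f := (singleOneRingHom : R →+* MonoidAlgebra R H)) ?_ p
    exact single_right_injective
  rw [powerSum, sum_pow_char p]
  simp [powerSum, single_pow]

theorem sum_coeff_mul_inv (x : MonoidAlgebra R H) :
    ∑ h, x.coeff h * x.coeff h⁻¹ = (x * x).coeff 1 := by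
  rw [coeff_mul_apply_left, Finsupp.sum_fintype _ _ (by simp)]
  simp

theorem sum_coeff (x : MonoidAlgebra R H) :
    ∑ h, x.coeff h = (x * powerSum R 1 (Set.univ : Set H)).coeff 1 := by
  rw [coeff_mul_apply_left, Finsupp.sum_fintype _ _ (by simp)]
  simp [coeff_powerSum_univ]

end GroupRing

theorem odd_ncard_of_inv_eq (hH : Odd (Nat.card H)) {T : Set H} (hT : T⁻¹ = T)
    (he : (1 : H) ∈ T) : Odd T.ncard := by
  have hfix (t : H) (ht : t⁻¹ = t) : t = 1 := by
    refine (powCoprime (n := 2) hH.coprime_two_right).injective ?_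
    simp only [powCoprime_apply, sq]
    nth_rw 1 [← ht]
    simp
  have hmem (t : H) : t⁻¹ ∈ T ↔ t ∈ T := by rw [← Set.mem_inv, hT]
  have h0 : ∑ _t ∈ T.toFinset.erase 1, (1 : ZMod 2) = 0 :=
    Finset.sum_involution (fun t _ => t⁻¹) (fun _ _ => by decide)
      (fun t ht _ h => (Finset.mem_erase.1 ht).1 (hfix t h))
      (fun t ht => by simpa [hmem] using ht) (fun _ _ => inv_inv _)
  rw [Finset.sum_const, nsmul_eq_mul, mul_one, ZMod.natCast_eq_zero_iff_even] at h0
  rw [Set.ncard_eq_toFinset_card', ← Finset.card_erase_add_one (Set.mem_toFinset.2 he)]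
  exact h0.add_one

namespace APLLEqs

variable {n : ℕ} {T₀ T₁ : Set H}

theorem mul_eq (R : Type*) [CommRing R] (h : APLLEqs n T₀ T₁) :
    powerSum R 1 T₀ * powerSum R 1 T₁ = powerSum R 1 Set.univ - 1 := by
  ext g
  rw [coeff_powerSum_mul, coeff_sub, Finsupp.sub_apply, coeff_powerSum_univ, one_def, coeff_single,
    Finsupp.single_apply]
  simp only [pow_one, h.1 g]
  by_cases hg : g = 1 <;> simp [hg, eq_comm (a := (1 : H))]

theorem sq_add_sq_eq (R : Type*) [CommRing R] (h : APLLEqs n T₀ T₁) :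
    powerSum R 1 T₀ * powerSum R 1 T₀ + powerSum R 1 T₁ * powerSum R 1 T₁
      + powerSum R 2 T₀ + powerSum R 2 T₁
      = 2 * powerSum R 1 Set.univ + 2 * (n : MonoidAlgebra R H) := by
  ext g
  have h2 := congrArg (Nat.cast (R := R)) (h.2 g)
  have hc : (2 * powerSum R 1 Set.univ + 2 * (n : MonoidAlgebra R H) : MonoidAlgebra R H)
      = (2 : R) • powerSum R 1 Set.univ + single 1 (2 * n : R) := by
    rw [two_mul, two_smul]
    congr 1
    rw [natCast_def, two_mul, ← single_add, two_mul]
  rw [hc]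
  simp only [coeff_add, Finsupp.add_apply, coeff_powerSum_mul, coeff_powerSum, pow_one, coeff_smul,
    Finsupp.smul_apply, coeff_single, Finsupp.single_apply]
  push_cast at h2
  rw [h2]
  by_cases hg : g = 1 <;> simp [hg, eq_comm (a := (1 : H))]

theorem disjoint (h : APLLEqs n T₀ T₁) (hT₁ : T₁⁻¹ = T₁) : Disjoint T₀ T₁ := by
  rw [Set.disjoint_left]
  intro t h0 h1
  have := h.1 1
  rw [if_pos rfl, Set.ncard_eq_zero] at this
  have hm : (t, t⁻¹) ∈ {p : H × H | p.1 ∈ T₀ ∧ p.2 ∈ T₁ ∧ p.1 * p.2 = 1} :=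
    ⟨h0, by rw [← hT₁]; simpa using h1, by simp⟩
  simp [this] at hm

theorem ncard_mul_ncard (h : APLLEqs n T₀ T₁) (hcard : Fintype.card H = n ^ 2 + n + 1) :
    T₀.ncard * T₁.ncard = n ^ 2 + n := by
  have h1 := congrArg (· * powerSum ℤ 1 Set.univ) (h.mul_eq ℤ)
  simp only [sub_mul, mul_assoc, powerSum_mul_univ, one_mul] at h1
  rw [mul_left_comm, powerSum_mul_univ, ← mul_assoc, ← Nat.cast_mul, ← nsmul_eq_mul,
    ← nsmul_eq_mul, Set.ncard_univ, Nat.card_eq_fintype_card, hcard] at h1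
  have h2 := congrArg (fun x => x.coeff 1) h1
  simp only [coeff_smul, coeff_sub, Finsupp.sub_apply, Finsupp.smul_apply,
    coeff_powerSum_univ] at h2
  simp only [nsmul_eq_mul, mul_one] at h2
  zify
  push_cast at h2
  linarith

theorem ncard_eq (h : APLLEqs n T₀ T₁) (hcard : Fintype.card H = n ^ 2 + n + 1)
    (hT₀ : T₀⁻¹ = T₀) (he : (1 : H) ∈ T₀) (hk : T₀.ncard + T₁.ncard = 2 * n + 1) (hn : Odd n) :
    T₀.ncard = n ∧ T₁.ncard = n + 1 := by
  have hmul := h.ncard_mul_ncard hcard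
  have hodd : Odd T₀.ncard := odd_ncard_of_inv_eq (odd_card hcard) hT₀ he
  have hor : (T₀.ncard - n : ℤ) * (T₀.ncard - (n + 1)) = 0 := by
    zify at hk hmul
    have : (T₁.ncard : ℤ) = 2 * n + 1 - T₀.ncard := by linarith
    rw [this] at hmul
    linarith
  rcases mul_eq_zero.1 hor with h0 | h0
  · omega
  · grind

theorem squares_mul_add_pow_three (R : Type*) [CommRing R] (h : APLLEqs n T₀ T₁)
    (hT₁ : T₁⁻¹ = T₁) (h₀ : T₀.ncard = n) (h₁ : T₁.ncard = n + 1) :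
    powerSum R 2 (T₀ ∪ T₁) * powerSum R 1 T₀ + powerSum R 1 T₀ ^ 3
      = (n - 1 : MonoidAlgebra R H) * powerSum R 1 Set.univ + powerSum R 1 T₁
        + 2 * (n : MonoidAlgebra R H) * powerSum R 1 T₀ := by
  have hA := powerSum_mul_univ R 1 T₀
  have hB := powerSum_mul_univ R 1 T₁
  rw [h₀] at hA
  rw [h₁] at hB
  push_cast at hB
  rw [powerSum_union R 2 (h.disjoint hT₁)]
  linear_combination powerSum R 1 T₀ * h.sq_add_sq_eq R - powerSum R 1 T₁ * h.mul_eq R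
    + 2 * hA - hB

theorem squares_sq (R : Type*) [CommRing R] (h : APLLEqs n T₀ T₁)
    (hcard : Fintype.card H = n ^ 2 + n + 1) (hT₁ : T₁⁻¹ = T₁) :
    powerSum R 2 (T₀ ∪ T₁) ^ 2 + powerSum R 4 (T₀ ∪ T₁)
      = 4 * powerSum R 1 Set.univ + 2 * (n : MonoidAlgebra R H) - 2 := by
  have h1 : (powerSum R 1 T₀ + powerSum R 1 T₁) ^ 2 + powerSum R 2 T₀ + powerSum R 2 T₁
      = 4 * powerSum R 1 Set.univ + 2 * (n : MonoidAlgebra R H) - 2 := by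
    linear_combination h.sq_add_sq_eq R + 2 * h.mul_eq R
  have h2 := congrArg (mapDomainRingHom R (powMonoidHom 2 : H →* H)) h1
  simp only [map_add, map_pow, map_sub, map_mul, mapDomainRingHom_powerSum, map_ofNat,
    map_natCast, Nat.reduceMul] at h2
  rw [powerSum_two_univ R ((odd_card hcard).coprime_two_right)] at h2
  rw [powerSum_union R _ (h.disjoint hT₁), powerSum_union R _ (h.disjoint hT₁), ← h2]
  ring

theorem sum_sq_count_le (h : APLLEqs n T₀ T₁) (hcard : Fintype.card H = n ^ 2 + n + 1)
    (hT₀ : T₀⁻¹ = T₀) (hT₁ : T₁⁻¹ = T₁) (he : (1 : H) ∈ T₀) (h₀ : T₀.ncard = n) :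
    ∑ g : H, ({p : H × H | p.1 ∈ T₀ ∪ T₁ ∧ p.2 ∈ T₀ ∧ p.1 ^ 2 * p.2 = g}.ncard : ℤ) ^ 2
      ≤ 6 * n ^ 2 - 3 * n := by
  set F := powerSum ℤ 2 (T₀ ∪ T₁) * powerSum ℤ 1 T₀ with hF
  have hFc (g : H) : F.coeff g
      = {p : H × H | p.1 ∈ T₀ ∪ T₁ ∧ p.2 ∈ T₀ ∧ p.1 ^ 2 * p.2 = g}.ncard := by
    rw [hF, coeff_powerSum_mul]
    simp only [pow_one]
  have hFinv (g : H) : F.coeff g⁻¹ = F.coeff g := by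
    rw [hFc, hFc, ← Set.ncard_inv]
    congr 3
    ext p
    have m₀ (t : H) : t⁻¹ ∈ T₀ ↔ t ∈ T₀ := by rw [← Set.mem_inv, hT₀]
    have m₁ (t : H) : t⁻¹ ∈ T₁ ↔ t ∈ T₁ := by rw [← Set.mem_inv, hT₁]
    simp only [Set.mem_inv, Set.mem_ofPred_eq, Set.mem_union, Prod.fst_inv, Prod.snd_inv, m₀, m₁,
      inv_pow, ← mul_inv, inv_inj]
  have hA : powerSum ℤ 1 T₀ * powerSum ℤ 1 Set.univ
      = (n : MonoidAlgebra ℤ H) * powerSum ℤ 1 Set.univ := by rw [powerSum_mul_univ, h₀]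
  have hFF : F * F = (4 * n ^ 2) • powerSum ℤ 1 Set.univ
      + (2 * n) • (powerSum ℤ 1 T₀ * powerSum ℤ 1 T₀) - 2 • (powerSum ℤ 1 T₀ * powerSum ℤ 1 T₀)
      - powerSum ℤ 4 (T₀ ∪ T₁) * (powerSum ℤ 1 T₀ * powerSum ℤ 1 T₀) := by
    simp only [nsmul_eq_mul]
    push_cast
    linear_combination powerSum ℤ 1 T₀ ^ 2 * h.squares_sq ℤ hcard hT₁
      + (4 * powerSum ℤ 1 T₀ + 4 * n) * hA
  have hAA : (powerSum ℤ 1 T₀ * powerSum ℤ 1 T₀).coeff 1 = n := by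
    rw [coeff_powerSum_mul, ← h₀]
    congr 1
    rw [← Set.ncard_image_of_injective T₀ (f := fun t => (t, t⁻¹)) fun a b hab => by simpa using hab]
    congr 1
    ext ⟨a, b⟩
    have m₀ (t : H) : t⁻¹ ∈ T₀ ↔ t ∈ T₀ := by rw [← Set.mem_inv, hT₀]
    simp only [pow_one, Set.mem_ofPred_eq, Set.mem_image, Prod.mk.injEq, mul_eq_one_iff_inv_eq]
    grind
  have hDAA : (n : ℤ)
      ≤ (powerSum ℤ 4 (T₀ ∪ T₁) * (powerSum ℤ 1 T₀ * powerSum ℤ 1 T₀)).coeff 1 := by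
    rw [powerSum, Finset.sum_mul, coeff_sum, Finsupp.finsetSum_apply, ← hAA]
    refine le_trans (le_of_eq ?_) (Finset.single_le_sum (a := 1) (fun t _ => ?_) ?_)
    · simp
    · rw [coeff_single_mul_apply, coeff_powerSum_mul]
      positivity
    · simp [he]
  have hsum := sum_coeff_mul_inv ℤ F
  simp only [hFinv, hFF, ← sq, hFc] at hsum
  rw [hsum]
  simp only [coeff_add, coeff_sub, coeff_smul, Finsupp.add_apply, Finsupp.sub_apply,
    Finsupp.smul_apply, coeff_powerSum_univ, ← sq] at hAA hDAA ⊢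
  rw [hAA]
  simp only [nsmul_eq_mul]
  push_cast
  linarith

theorem sum_count (h : APLLEqs n T₀ T₁) (hT₁ : T₁⁻¹ = T₁) (h₀ : T₀.ncard = n)
    (h₁ : T₁.ncard = n + 1) :
    ∑ g : H, ({p : H × H | p.1 ∈ T₀ ∪ T₁ ∧ p.2 ∈ T₀ ∧ p.1 ^ 2 * p.2 = g}.ncard : ℤ)
      = n * (2 * n + 1) := by
  have hs := sum_coeff ℤ (powerSum ℤ 2 (T₀ ∪ T₁) * powerSum ℤ 1 T₀)
  rw [mul_assoc, powerSum_mul_univ, mul_left_comm, powerSum_mul_univ,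
    Set.ncard_union_eq (h.disjoint hT₁), h₀, h₁, ← mul_assoc, ← Nat.cast_mul, ← nsmul_eq_mul,
    coeff_smul, Finsupp.smul_apply, coeff_powerSum_univ] at hs
  simp only [coeff_powerSum_mul, pow_one] at hs
  rw [hs, nsmul_eq_mul]
  push_cast
  ring

theorem count_congr (h : APLLEqs n T₀ T₁) (hT₁ : T₁⁻¹ = T₁) (h₀ : T₀.ncard = n)
    (h₁ : T₁.ncard = n + 1) (hn : n % 3 = 1) (g : H) :
    ({p : H × H | p.1 ∈ T₀ ∪ T₁ ∧ p.2 ∈ T₀ ∧ p.1 ^ 2 * p.2 = g}.ncard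
        + {t : H | t ∈ T₀ ∧ t ^ 3 = g}.ncard) % 3
      = ((if g ∈ T₁ then 1 else 0) + 2 * (if g ∈ T₀ then 1 else 0)) % 3 := by
  have hind (T : Set H) : {t : H | t ∈ T ∧ t = g}.ncard = if g ∈ T then 1 else 0 := by
    split_ifs with hg
    · rw [Set.ncard_eq_one]
      exact ⟨g, by ext t; simp; grind⟩
    · rw [Set.ncard_eq_zero]
      ext t; simp; grind
  have hn3 : (n : MonoidAlgebra (ZMod 3) H) = 1 := by
    have : (n : ZMod 3) = 1 := by
      rw [← Nat.cast_one, ZMod.natCast_eq_natCast_iff']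
      exact hn
    rw [natCast_def, this, one_def]
  have hmain := h.squares_mul_add_pow_three (ZMod 3) hT₁ h₀ h₁
  rw [powerSum_one_pow_char, hn3, sub_self, zero_mul, zero_add, mul_one, two_mul] at hmain
  have hg := congrArg (fun x => x.coeff g) hmain
  simp only [coeff_add, Finsupp.add_apply, coeff_powerSum, coeff_powerSum_mul, pow_one,
    hind] at hg
  rw [← two_mul] at hg
  exact (ZMod.natCast_eq_natCast_iff' _ _ 3).1 (by push_cast at hg ⊢; exact hg)

end APLLEqs

end

/-- For `n ≡ 1 (mod 6)`, the sizes of the coefficient classes `X_i` of `T̂⁽²⁾T₀` are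
determined: `3|X₀| = (n−1)²`, `|X₁| = n+2`, `|X₂| = 2n−2`, `3|X₃| = 2(n−1)²`, and
`|X_i| = 0` for `i > 3`. -/
theorem Xi_values_n_eq_one_mod_six (n : ℕ) (hn : 0 < n) (hmod : n % 6 = 1)
    {H : Type*} [CommGroup H] [Fintype H]
    (hcard : Fintype.card H = n ^ 2 + n + 1)
    (T₀ T₁ : Set H) (hT₀inv : T₀⁻¹ = T₀) (hT₁inv : T₁⁻¹ = T₁)
    (he : (1 : H) ∈ T₀) (hk : T₀.ncard + T₁.ncard = 2 * n + 1)
    (hAPLL : APLLEqs n T₀ T₁) :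
    3 * ((Xset T₀ T₁ 0).ncard : ℤ) = ((n : ℤ) - 1) ^ 2 ∧
    ((Xset T₀ T₁ 1).ncard : ℤ) = (n : ℤ) + 2 ∧
    ((Xset T₀ T₁ 2).ncard : ℤ) = 2 * (n : ℤ) - 2 ∧
    3 * ((Xset T₀ T₁ 3).ncard : ℤ) = 2 * ((n : ℤ) - 1) ^ 2 ∧
    ∀ i : ℕ, 3 < i → (Xset T₀ T₁ i).ncard = 0 := by
  obtain ⟨h₀, h₁⟩ := hAPLL.ncard_eq hcard hT₀inv he hk (Nat.odd_iff.2 (by omega))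
  have hmoments := card_filter_eq_of_moments
    (fun g => {p : H × H | p.1 ∈ T₀ ∪ T₁ ∧ p.2 ∈ T₀ ∧ p.1 ^ 2 * p.2 = g}.ncard)
    T₀.toFinset T₁.toFinset (fun t => t ^ 3) (Set.mem_toFinset.2 he) (one_pow 3)
    (Set.disjoint_toFinset.2 (hAPLL.disjoint hT₁inv))
    (by rw [← Set.ncard_eq_toFinset_card', h₀]) (by rw [← Set.ncard_eq_toFinset_card', h₁]) hcard
    (hAPLL.sum_count hT₁inv h₀ h₁) (hAPLL.sum_sq_count_le hcard hT₀inv hT₁inv he h₀)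
    (fun g => by
      have hg := hAPLL.count_congr hT₁inv h₀ h₁ (by omega) g
      rw [Set.ncard_eq_toFinset_card' {t : H | t ∈ T₀ ∧ t ^ 3 = g}] at hg
      simp only [Set.mem_toFinset]
      convert hg using 4
      ext t
      simp)
  have hX (i : ℕ) : (Xset T₀ T₁ i).ncard
      = #{g : H | {p : H × H | p.1 ∈ T₀ ∪ T₁ ∧ p.2 ∈ T₀ ∧ p.1 ^ 2 * p.2 = g}.ncard = i} := by
    rw [Set.ncard_eq_toFinset_card']
    congr 1
    ext g
    rw [Set.mem_toFinset, Finset.mem_filter_univ]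
    rfl
  obtain ⟨m₀, m₁, m₂, m₃, hle⟩ := hmoments
  simp only [hX]
  refine ⟨m₀, m₁, m₂, m₃, fun i hi => ?_⟩
  rw [Finset.card_eq_zero, Finset.filter_eq_empty_iff]
  exact fun g _ hg => absurd (hle g) (by omega)
end

section
/- Let n be a positive integer with n ≡ 1 (mod 6), H a finite abelian group of order n²+n+1, and T₀, T₁ inverse-closed subsets of H with e ∈ T₀ and |T₀| + |T₁| = 2n+1 satisfying the APLL group-ring equations. Let u₀ = |{h ∈ T₀ : ∃ t ∈ T₁, t³ = h}|, u₁ = |{h ∈ T₁ : ∃ t ∈ T₁, t³ = h}|, Δ₁ = {h ∈ H : #{t ∈ T₁ : t³ = h} = 2}, Δ₁¹ = Δ₁ ∩ T₁ and Δ₁² = Δ₁ ∖ (T₀ ∪ T₁). Then, as inequalities of rational numbers: 2n² − 5n − 4 + θ₁ + 3(2u₀ + u₁ + 2|Δ₁¹| + |Δ₁²|) ≤ 3|Y₃| ≤ 2n² − 2n − 3 + 3(u₀ + u₁ + |Δ₁¹| + |Δ₁²|), and n² − 10n − 3 − 3(u₀ + u₁ + |Δ₁¹| + |Δ₁²|)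 + 3θ₁ ≤ 3|Y₀| ≤ n² − n + 1 − θ₁. -/
open scoped Classical Pointwise

open Finset

/-- The element `∑ i ∈ s, f i` of the group algebra `R[H]`. -/
noncomputable def groupSum (R : Type*) [CommRing R] {H ι : Type*} (f : ι → H) (s : Finset ι) :
    MonoidAlgebra R H :=
  ∑ i ∈ s, MonoidAlgebra.single (f i) 1

section GroupSum

variable {R : Type*} [CommRing R] {H ι κ : Type*}

theorem coeff_groupSum (f : ι → H) (s : Finset ι) (h : H) :
    (groupSum R f s).coeff h = (#{i ∈ s | f i = h} : R) := by
  simp [groupSum, Finsupp.finsetSum_apply, Finsupp.single_apply]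

theorem groupSum_disjUnion {f : ι → H} {s t : Finset ι} (hd : Disjoint s t) :
    groupSum R f (s ∪ t) = groupSum R f s + groupSum R f t :=
  Finset.sum_union hd

theorem card_filter_univ_eq_self [Fintype H] (h : H) : #{x : H | x = h} = 1 :=
  Finset.card_eq_one.2 ⟨h, by ext; simp⟩

variable [CommGroup H]

theorem groupSum_mul_groupSum (f : ι → H) (g : κ → H) (s : Finset ι) (t : Finset κ) :
    groupSum R f s * groupSum R g t = groupSum R (fun p : ι × κ => f p.1 * g p.2) (s ×ˢ t) := by
  simp [groupSum, Finset.sum_mul_sum, Finset.sum_product]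

theorem groupSum_univ_mul [Fintype H] (f : ι → H) (s : Finset ι) :
    groupSum R id (univ : Finset H) * groupSum R f s
      = (#s : MonoidAlgebra R H) * groupSum R id (univ : Finset H) := by
  simp only [groupSum, Finset.mul_sum, id, ← nsmul_eq_mul, ← Finset.sum_const]
  rw [Finset.sum_comm]
  refine Finset.sum_congr rfl fun i _ => ?_
  simp only [Finset.sum_mul, MonoidAlgebra.single_mul_single, mul_one]
  exact Fintype.sum_equiv (Equiv.mulRight (f i)) _ (fun x => MonoidAlgebra.single x 1) fun x => rfl

end GroupSum

section Pairs

variable {H : Type*} [CommGroup H] {n : ℕ} {A B : Finset H}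

theorem coeff_groupSum_mul {R : Type*} [CommRing R] {ι : Type*} (f : ι → H) (s : Finset ι)
    (x : MonoidAlgebra R H) (h : H) :
    (groupSum R f s * x).coeff h = ∑ i ∈ s, x.coeff ((f i)⁻¹ * h) := by
  simp [groupSum, Finset.sum_mul, Finsupp.finsetSum_apply]

theorem disjoint_of_card_mul_eq (hBinv : ∀ x ∈ B, x⁻¹ ∈ B)
    (h01 : ∀ h : H, #{p ∈ A ×ˢ B | p.1 * p.2 = h} = if h = 1 then 0 else 1) :
    Disjoint A B := by
  refine Finset.disjoint_left.2 fun x hxA hxB => ?_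
  have h := h01 1
  rw [if_pos rfl, Finset.card_eq_zero] at h
  have : (x, x⁻¹) ∈ ({p ∈ A ×ˢ B | p.1 * p.2 = 1} : Finset (H × H)) := by
    simp [hxA, hBinv x hxB]
  simp [h] at this

theorem even_card_of_inv_mem (hinj : Function.Injective fun x : H => x ^ 2)
    (hBinv : ∀ x ∈ B, x⁻¹ ∈ B) (h1 : (1 : H) ∉ B) : Even #B := by
  have : ∑ _b ∈ B, (1 : ZMod 2) = 0 := by
    refine Finset.sum_involution (fun x _ => x⁻¹) (fun _ _ => by decide) ?_ hBinv
      (fun x _ => inv_inv x)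
    intro x hx _ hxx
    have : x = 1 := hinj (by simp only [pow_two]; nth_rw 1 [← hxx]; simp)
    exact h1 (this ▸ hx)
  rw [← ZMod.natCast_eq_zero_iff_even]
  simpa using this

theorem card_mul_self_eq (hinj : Function.Injective fun x : H => x ^ 2)
    (hBinv : ∀ x ∈ B, x⁻¹ ∈ B) (h1 : (1 : H) ∉ B)
    (hsq : ∀ h : H, #{p ∈ A ×ˢ A | p.1 * p.2 = h} + #{p ∈ B ×ˢ B | p.1 * p.2 = h}
      + #{t ∈ A | t ^ 2 = h} + #{t ∈ B | t ^ 2 = h} = 2 + if h = 1 then 2 * n else 0) (h : H) :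
    #{p ∈ B ×ˢ B | p.1 * p.2 = h} = (if h = 1 then #B else 0)
      + (if h ∈ B.image (· ^ 2) then 1 else 0)
      + 2 * (if h ∈ (B * B) \ (B.image (· ^ 2) ∪ {1}) then 1 else 0) := by
  rcases eq_or_ne h 1 with rfl | hh
  · have h2 : (1 : H) ∉ B.image (· ^ 2) := by
      simp only [Finset.mem_image, not_exists, not_and]
      intro x hx hx2
      exact h1 (hinj (a₁ := x) (a₂ := 1) (by simpa using hx2) ▸ hx)
    simp only [h2, if_true, if_false, Finset.mem_sdiff, Finset.mem_union, Finset.mem_singleton,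
      or_true, not_true, and_false, add_zero, mul_zero]
    refine Finset.card_nbij' Prod.fst (fun x => (x, x⁻¹)) ?_ ?_ ?_ ?_
    · intro p; simp +contextual
    · intro p; simp +contextual [hBinv]
    · rintro ⟨p, q⟩; simp +contextual [inv_eq_iff_mul_eq_one]
    · intro p; simp
  · have hs := hsq h
    rw [if_neg hh, add_zero] at hs
    by_cases hq : h ∈ B.image (· ^ 2)
    · obtain ⟨t, ht, rfl⟩ := Finset.mem_image.1 hq
      have e1 : 0 < #{s ∈ B | s ^ 2 = t ^ 2} := Finset.card_pos.2 ⟨t, by simp [ht]⟩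
      have e2 : 0 < #{p ∈ B ×ˢ B | p.1 * p.2 = t ^ 2} :=
        Finset.card_pos.2 ⟨(t, t), by simp [ht, pow_two]⟩
      simp only [hh, hq, if_true, if_false, Finset.mem_sdiff, Finset.mem_union, true_or,
        not_true, and_false]
      omega
    · simp only [hh, hq, if_false, Finset.mem_sdiff, Finset.mem_union, Finset.mem_singleton,
        or_self, not_false_eq_true, and_true]
      by_cases hm : h ∈ B * B
      · obtain ⟨x, hx, y, hy, rfl⟩ := Finset.mem_mul.1 hm
        have hxy : x ≠ y := by
          rintro rfl
          exact hq (Finset.mem_image.2 ⟨x, hx, pow_two x⟩)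
        have e2 : 1 < #{p ∈ B ×ˢ B | p.1 * p.2 = x * y} :=
          Finset.one_lt_card.2 ⟨(x, y), by simp [hx, hy], (y, x), by simp [hx, hy, mul_comm],
            by simp [hxy]⟩
        rw [if_pos hm]
        omega
      · rw [if_neg hm, Finset.card_eq_zero.2]
        refine Finset.filter_eq_empty_iff.2 ?_
        rintro ⟨x, y⟩ hp rfl
        exact hm (Finset.mul_mem_mul (Finset.mem_product.1 hp).1 (Finset.mem_product.1 hp).2)

theorem sum_ite_pow_mem (T S : Finset H) {k : ℕ}
    (hinj : Function.Injective fun x : H => x ^ k) :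
    ∑ g ∈ T, (if g ^ k ∈ S then 1 else 0) = #(S ∩ T.image (· ^ k)) := by
  rw [← Finset.card_filter, ← Finset.card_image_of_injective _ hinj]
  congr 1
  ext x
  simp only [Finset.mem_image, Finset.mem_filter, Finset.mem_inter]
  constructor
  · rintro ⟨g, ⟨hg, hS⟩, rfl⟩
    exact ⟨hS, g, hg, rfl⟩
  · rintro ⟨hS, g, hg, rfl⟩
    exact ⟨g, ⟨hg, hS⟩, rfl⟩

variable [Fintype H]

theorem groupSum_mul_eq_univ_sub_one (R : Type*) [CommRing R]
    (h01 : ∀ h : H, #{p ∈ A ×ˢ B | p.1 * p.2 = h} = if h = 1 then 0 else 1) :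
    groupSum R id A * groupSum R id B = groupSum R id univ - 1 := by
  rw [groupSum_mul_groupSum]
  ext h
  simp only [MonoidAlgebra.coeff_sub, Finsupp.sub_apply, coeff_groupSum, id, h01,
    MonoidAlgebra.one_def, MonoidAlgebra.coeff_single, Finsupp.single_apply, eq_comm (a := h)]
  split_ifs <;> simp [card_filter_univ_eq_self]

theorem groupSum_sq_add_sq (R : Type*) [CommRing R]
    (hsq : ∀ h : H, #{p ∈ A ×ˢ A | p.1 * p.2 = h} + #{p ∈ B ×ˢ B | p.1 * p.2 = h}
      + #{t ∈ A | t ^ 2 = h} + #{t ∈ B | t ^ 2 = h} = 2 + if h = 1 then 2 * n else 0) :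
    groupSum R id A ^ 2 + groupSum R id B ^ 2
      = 2 * groupSum R id univ - groupSum R (· ^ 2) A - groupSum R (· ^ 2) B
        + 2 * (n : MonoidAlgebra R H) := by
  rw [sub_sub, sub_add_eq_add_sub, eq_sub_iff_add_eq, pow_two, pow_two, groupSum_mul_groupSum,
    groupSum_mul_groupSum, two_mul,
    show (2 : MonoidAlgebra R H) * n = ((2 * n : ℕ) : MonoidAlgebra R H) by push_cast; rfl,
    MonoidAlgebra.natCast_def]
  ext h
  have := congrArg (Nat.cast : ℕ → R) (hsq h)
  simp only [MonoidAlgebra.coeff_add, Finsupp.add_apply, coeff_groupSum, id,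
    MonoidAlgebra.coeff_single, Finsupp.single_apply]
  push_cast at this
  rw [← add_assoc, this]
  simp only [eq_comm (a := h)]
  simp [card_filter_univ_eq_self, one_add_one_eq_two]

/-- The square of `T̂`. -/
theorem groupSum_union_sq (R : Type*) [CommRing R] (hd : Disjoint A B)
    (h01 : ∀ h : H, #{p ∈ A ×ˢ B | p.1 * p.2 = h} = if h = 1 then 0 else 1)
    (hsq : ∀ h : H, #{p ∈ A ×ˢ A | p.1 * p.2 = h} + #{p ∈ B ×ˢ B | p.1 * p.2 = h}
      + #{t ∈ A | t ^ 2 = h} + #{t ∈ B | t ^ 2 = h} = 2 + if h = 1 then 2 * n else 0) :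
    groupSum R id (A ∪ B) ^ 2 = 4 * groupSum R id univ - groupSum R (· ^ 2) (A ∪ B)
      + (2 * (n : MonoidAlgebra R H) - 2) := by
  rw [groupSum_disjUnion hd, groupSum_disjUnion hd]
  linear_combination groupSum_sq_add_sq R hsq + 2 * groupSum_mul_eq_univ_sub_one R h01

theorem groupSum_sq_mul (R : Type*) [CommRing R] (hd : Disjoint A B)
    (hA : #A = n) (hB : #B = n + 1)
    (h01 : ∀ h : H, #{p ∈ A ×ˢ B | p.1 * p.2 = h} = if h = 1 then 0 else 1)
    (hsq : ∀ h : H, #{p ∈ A ×ˢ A | p.1 * p.2 = h} + #{p ∈ B ×ˢ B | p.1 * p.2 = h}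
      + #{t ∈ A | t ^ 2 = h} + #{t ∈ B | t ^ 2 = h} = 2 + if h = 1 then 2 * n else 0) :
    groupSum R (· ^ 2) (A ∪ B) * groupSum R id B
      = ((n : MonoidAlgebra R H) + 2) * groupSum R id univ + groupSum R id A
        + 2 * (n : MonoidAlgebra R H) * groupSum R id B - groupSum R id B ^ 3 := by
  have h1 := groupSum_mul_eq_univ_sub_one R h01
  have h2 := groupSum_union_sq R hd h01 hsq
  have h3 := groupSum_univ_mul (R := R) id A
  have h4 := groupSum_univ_mul (R := R) id B
  rw [groupSum_disjUnion (f := id) hd] at h2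
  rw [hA] at h3
  rw [hB] at h4
  push_cast at h4
  linear_combination groupSum R id B * h2 - (groupSum R id A + 2 * groupSum R id B) * h1
    - h3 + 2 * h4

theorem card_mul_card (hcard : Fintype.card H = n ^ 2 + n + 1)
    (h01 : ∀ h : H, #{p ∈ A ×ˢ B | p.1 * p.2 = h} = if h = 1 then 0 else 1) :
    #A * #B = n * (n + 1) := by
  rw [← Finset.card_product,
    Finset.card_eq_sum_card_fiberwise (f := fun p : H × H => p.1 * p.2) (t := univ) (by simp),
    Finset.sum_congr rfl fun h _ => h01 h]
  have := Finset.sum_add_sum_compl ({1} : Finset H) (fun h => if h = 1 then 0 else 1)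
  have h2 : ∑ h ∈ ({1} : Finset H)ᶜ, (if h = 1 then 0 else 1) = n * (n + 1) := by
    rw [Finset.sum_congr rfl (g := fun _ => 1) (by simp +contextual)]
    simp [Finset.card_compl, hcard]
    ring
  rw [← this, h2]
  simp

theorem sum_card_sq_mul_sq (hinj : Function.Injective fun x : H => x ^ 2)
    (hAinv : ∀ x ∈ A, x⁻¹ ∈ A) (hBinv : ∀ x ∈ B, x⁻¹ ∈ B) (h1 : (1 : H) ∈ A)
    (hB : #B = n + 1)
    (h01 : ∀ h : H, #{p ∈ A ×ˢ B | p.1 * p.2 = h} = if h = 1 then 0 else 1)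
    (hsq : ∀ h : H, #{p ∈ A ×ˢ A | p.1 * p.2 = h} + #{p ∈ B ×ˢ B | p.1 * p.2 = h}
      + #{t ∈ A | t ^ 2 = h} + #{t ∈ B | t ^ 2 = h} = 2 + if h = 1 then 2 * n else 0) :
    ∑ h : H, (#{p ∈ (A ∪ B) ×ˢ B | p.1 ^ 2 * p.2 = h} : ℤ) ^ 2
      = (n + 1) * (6 * n + 1) - #(B ∩ (A ∪ B).image (· ^ 2))
        - 2 * #(((B * B) \ (B.image (· ^ 2) ∪ {1})) ∩ (A ∪ B).image (· ^ 4)) := by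
  have hd := disjoint_of_card_mul_eq hBinv h01
  have h1B : (1 : H) ∉ B := Finset.disjoint_left.1 hd h1
  have hinj4 : Function.Injective fun x : H => x ^ 4 := by
    have : (fun x : H => x ^ 4) = (fun x => x ^ 2) ∘ (fun x => x ^ 2) := by
      ext x; simp [← pow_mul]
    rw [this]
    exact hinj.comp hinj
  have hTinv : ∀ x ∈ A ∪ B, x⁻¹ ∈ A ∪ B := fun x hx => by
    rcases Finset.mem_union.1 hx with hx | hx
    · exact Finset.mem_union_left _ (hAinv x hx)
    · exact Finset.mem_union_right _ (hBinv x hx)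
  set X := groupSum ℤ (fun p : H × H => p.1 ^ 2 * p.2) ((A ∪ B) ×ˢ B) with hX
  have hXmul : X = groupSum ℤ (· ^ 2) (A ∪ B) * groupSum ℤ id B := by
    rw [groupSum_mul_groupSum]; rfl
  have hXc (h : H) : X.coeff h = #{p ∈ (A ∪ B) ×ˢ B | p.1 ^ 2 * p.2 = h} := coeff_groupSum ..
  have hXinv (h : H) : X.coeff h⁻¹ = X.coeff h := by
    rw [hXc, hXc, Nat.cast_inj]
    refine Finset.card_nbij' (·⁻¹) (·⁻¹) ?_ ?_ (by simp [Set.LeftInvOn])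
      (by simp [Set.RightInvOn, Set.LeftInvOn])
    · rintro ⟨x, y⟩ h
      simp only [Finset.coe_filter, Finset.mem_product, Set.mem_ofPred_eq, Prod.inv_mk] at h ⊢
      refine ⟨⟨hTinv _ h.1.1, hBinv _ h.1.2⟩, ?_⟩
      rw [inv_pow, ← mul_inv, h.2, inv_inv]
    · rintro ⟨x, y⟩ h
      simp only [Finset.coe_filter, Finset.mem_product, Set.mem_ofPred_eq, Prod.inv_mk] at h ⊢
      refine ⟨⟨hTinv _ h.1.1, hBinv _ h.1.2⟩, ?_⟩
      rw [inv_pow, ← mul_inv, h.2]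
  have hsum : ∑ h : H, (#{p ∈ (A ∪ B) ×ˢ B | p.1 ^ 2 * p.2 = h} : ℤ) ^ 2 = (X * X).coeff 1 := by
    nth_rw 1 [hX]
    rw [coeff_groupSum_mul, ← Finset.sum_fiberwise_of_maps_to (t := univ)
      (g := fun p : H × H => p.1 ^ 2 * p.2) (by simp)]
    refine Finset.sum_congr rfl fun h _ => ?_
    rw [Finset.sum_congr rfl (g := fun _ => X.coeff h)]
    · rw [Finset.sum_const, hXc, nsmul_eq_mul, pow_two]
    · intro p hp
      rw [mul_one, (Finset.mem_filter.1 hp).2, hXinv]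
  have hP2 : groupSum ℤ (· ^ 2) (A ∪ B) ^ 2 = 4 * groupSum ℤ id (univ : Finset H)
      - groupSum ℤ (· ^ 4) (A ∪ B) + (2 * (n : MonoidAlgebra ℤ H) - 2) := by
    have key := congrArg (MonoidAlgebra.mapDomainRingHom ℤ (powMonoidHom 2 : H →* H))
      (groupSum_union_sq ℤ hd h01 hsq)
    have hm (f : H → H) (T : Finset H) : MonoidAlgebra.mapDomainRingHom ℤ (powMonoidHom 2 : H →* H)
        (groupSum ℤ f T) = groupSum ℤ (fun x => f x ^ 2) T := by
      simp [groupSum, map_sum, MonoidAlgebra.mapDomain_single]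
    have hU : groupSum ℤ (fun x : H => x ^ 2) univ = groupSum ℤ id (univ : Finset H) :=
      Fintype.sum_equiv (Equiv.ofBijective _ (Finite.injective_iff_bijective.1 hinj)) _ _
        fun x => rfl
    simp only [map_pow, map_add, map_sub, map_mul, map_ofNat, map_natCast, hm, id, hU,
      ← pow_mul] at key
    exact key
  have hUB := groupSum_univ_mul (R := ℤ) (id : H → H) B
  rw [hB] at hUB
  have hXX : X * X = ((4 * (n + 1) ^ 2 : ℕ) : MonoidAlgebra ℤ H) * groupSum ℤ id univ
      - groupSum ℤ (· ^ 4) (A ∪ B) * (groupSum ℤ id B * groupSum ℤ id B)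
      + ((2 * n : ℕ) : MonoidAlgebra ℤ H) * (groupSum ℤ id B * groupSum ℤ id B)
      - groupSum ℤ id B * groupSum ℤ id B - groupSum ℤ id B * groupSum ℤ id B := by
    push_cast at hUB ⊢
    rw [hXmul]
    linear_combination groupSum ℤ id B ^ 2 * hP2
      + 4 * (groupSum ℤ id B + (n + 1 : MonoidAlgebra ℤ H)) * hUB
  have hr (h : H) : (groupSum ℤ id B * groupSum ℤ id B).coeff h
      = (#{p ∈ B ×ˢ B | p.1 * p.2 = h} : ℤ) := by
    rw [groupSum_mul_groupSum, coeff_groupSum]; rfl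
  have hr1 := card_mul_self_eq hinj hBinv h1B hsq
  have h4 : (groupSum ℤ (· ^ 4) (A ∪ B) * (groupSum ℤ id B * groupSum ℤ id B)).coeff 1
      = (n + 1 : ℤ) + #(B ∩ (A ∪ B).image (· ^ 2))
        + 2 * #(((B * B) \ (B.image (· ^ 2) ∪ {1})) ∩ (A ∪ B).image (· ^ 4)) := by
    rw [coeff_groupSum_mul]
    have : ∑ g ∈ A ∪ B, #{p ∈ B ×ˢ B | p.1 * p.2 = g ^ 4} = (n + 1)
        + #(B ∩ (A ∪ B).image (· ^ 2))
        + 2 * #(((B * B) \ (B.image (· ^ 2) ∪ {1})) ∩ (A ∪ B).image (· ^ 4)) := by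
      simp only [hr1, Finset.sum_add_distrib, ← Finset.mul_sum]
      rw [sum_ite_pow_mem _ ((B * B) \ (B.image (· ^ 2) ∪ {1})) hinj4, ← sum_ite_pow_mem _ _ hinj]
      congr 2
      · rw [Finset.sum_eq_single_of_mem 1 (Finset.mem_union_left _ h1)]
        · simp [hB]
        · intro g _ hg
          rw [if_neg]
          exact fun h => hg (hinj4 (by simpa using h))
      · refine Finset.sum_congr rfl fun g _ => ?_
        congr 1
        rw [show g ^ 4 = (g ^ 2) ^ 2 by rw [← pow_mul], eq_iff_iff]
        exact hinj.mem_finset_image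
    rw [← Finset.sum_nbij' (s := A ∪ B) (t := A ∪ B) (·⁻¹) (·⁻¹) hTinv hTinv (by simp) (by simp)
      (f := fun g => (#{p ∈ B ×ˢ B | p.1 * p.2 = g ^ 4} : ℤ)) (fun g _ => by rw [hr]; simp)]
    exact_mod_cast this
  have hnat (k : ℕ) (x : MonoidAlgebra ℤ H) :
      ((k : MonoidAlgebra ℤ H) * x).coeff 1 = k * x.coeff 1 := by
    rw [← nsmul_eq_mul, MonoidAlgebra.coeff_smul, Finsupp.smul_apply, nsmul_eq_mul]
  have hB1 : #{p ∈ B ×ˢ B | p.1 * p.2 = 1} = n + 1 := by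
    have : (1 : H) ∉ B.image (· ^ 2) := by
      simp only [Finset.mem_image, not_exists, not_and]
      intro x hx hx2
      exact h1B (hinj (a₁ := x) (a₂ := 1) (by simpa using hx2) ▸ hx)
    rw [hr1]
    simp only [this, hB, if_true, if_false, Finset.mem_sdiff, Finset.mem_union,
      Finset.mem_singleton, or_true, not_true, and_false, add_zero, mul_zero]
  rw [hsum, hXX]
  simp only [MonoidAlgebra.coeff_sub, MonoidAlgebra.coeff_add, Finsupp.sub_apply,
    Finsupp.add_apply, hnat, h4, hr, hB1]
  simp only [coeff_groupSum, id, card_filter_univ_eq_self]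
  push_cast
  ring

theorem card_sq_mul_cast_zmod_three (hd : Disjoint A B) (hn3 : n % 3 = 1)
    (hA : #A = n) (hB : #B = n + 1)
    (h01 : ∀ h : H, #{p ∈ A ×ˢ B | p.1 * p.2 = h} = if h = 1 then 0 else 1)
    (hsq : ∀ h : H, #{p ∈ A ×ˢ A | p.1 * p.2 = h} + #{p ∈ B ×ˢ B | p.1 * p.2 = h}
      + #{t ∈ A | t ^ 2 = h} + #{t ∈ B | t ^ 2 = h} = 2 + if h = 1 then 2 * n else 0) (h : H) :
    (#{p ∈ (A ∪ B) ×ˢ B | p.1 ^ 2 * p.2 = h} + #{t ∈ B | t ^ 3 = h}) % 3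
      = ((if h ∈ A then 1 else 0) + 2 * (if h ∈ B then 1 else 0)) % 3 := by
  have := charP_of_injective_algebraMap
    (FaithfulSMul.algebraMap_injective (ZMod 3) (MonoidAlgebra (ZMod 3) H)) 3
  have hn1 : (n : MonoidAlgebra (ZMod 3) H) = 1 := by
    simpa using (CharP.natCast_eq_natCast (MonoidAlgebra (ZMod 3) H) 3 (a := n) (b := 1)).2 hn3
  have h3 : (3 : MonoidAlgebra (ZMod 3) H) = 0 := by
    simpa using CharP.cast_eq_zero (MonoidAlgebra (ZMod 3) H) 3
  have hcube : groupSum (ZMod 3) id B ^ 3 = groupSum (ZMod 3) (· ^ 3) B := by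
    have : Fact (Nat.Prime 3) := ⟨Nat.prime_three⟩
    simp [groupSum, sum_pow_char 3]
  have key := groupSum_sq_mul (ZMod 3) hd hA hB h01 hsq
  rw [hcube, hn1, groupSum_mul_groupSum] at key
  have key2 : groupSum (ZMod 3) (fun p : H × H => p.1 ^ 2 * id p.2) ((A ∪ B) ×ˢ B)
      + groupSum (ZMod 3) (· ^ 3) B
      = groupSum (ZMod 3) id A + (groupSum (ZMod 3) id B + groupSum (ZMod 3) id B) := by
    linear_combination key + groupSum (ZMod 3) id univ * h3
  have hmem (S : Finset H) : #{x ∈ S | x = h} = if h ∈ S then 1 else 0 := by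
    split_ifs with hS
    · exact Finset.card_eq_one.2 ⟨h, by ext; simp +contextual [hS]⟩
    · refine Finset.card_eq_zero.2 (Finset.filter_eq_empty_iff.2 ?_)
      rintro x hx rfl
      exact hS hx
  have key3 := congrArg (fun x => x.coeff h) key2
  simp only [MonoidAlgebra.coeff_add, Finsupp.add_apply, coeff_groupSum, id, hmem] at key3
  rw [two_mul]
  exact (ZMod.natCast_eq_natCast_iff' _ _ 3).1 (by push_cast at key3 ⊢; exact key3)

theorem card_cube_eq_le_two (hcard : Fintype.card H = n ^ 2 + n + 1)
    (hBinv : ∀ x ∈ B, x⁻¹ ∈ B)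
    (hsq : ∀ h : H, #{p ∈ A ×ˢ A | p.1 * p.2 = h} + #{p ∈ B ×ˢ B | p.1 * p.2 = h}
      + #{t ∈ A | t ^ 2 = h} + #{t ∈ B | t ^ 2 = h} = 2 + if h = 1 then 2 * n else 0) (h : H) :
    #{t ∈ B | t ^ 3 = h} ≤ 2 := by
  by_contra! hlt
  obtain ⟨x, y, z, hx, hy, hz, hxy, hxz, hyz⟩ := Finset.two_lt_card_iff.1 hlt
  simp only [Finset.mem_filter] at hx hy hz
  have hK : Nat.card (powMonoidHom 3 : H →* H).ker ≤ 3 := by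
    have : Fact (Nat.Prime 3) := ⟨Nat.prime_three⟩
    have hp : IsPGroup 3 (powMonoidHom 3 : H →* H).ker := by
      rintro ⟨g, hg⟩
      exact ⟨1, by ext; simpa using hg⟩
    obtain ⟨k, hk⟩ := IsPGroup.iff_card.1 hp
    have hdvd := (powMonoidHom 3 : H →* H).ker.card_subgroup_dvd_card
    rw [hk, Nat.card_eq_fintype_card, hcard] at hdvd
    have hk1 : k ≤ 1 := by
      by_contra! hk2
      have h9 : 9 ∣ n ^ 2 + n + 1 := (pow_dvd_pow 3 hk2).trans hdvd
      have hmod : (n ^ 2 + n + 1) % 9 ≠ 0 := by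
        have : n % 9 < 9 := Nat.mod_lt _ (by norm_num)
        rw [Nat.add_mod, Nat.add_mod (n ^ 2), Nat.pow_mod]
        interval_cases n % 9 <;> simp
      exact hmod (Nat.mod_eq_zero_of_dvd h9)
    rw [hk]
    exact Nat.pow_le_pow_right (by norm_num) hk1
  have hw3 : (y * x⁻¹) ^ 3 = 1 := by rw [mul_pow, inv_pow, hx.2, hy.2, mul_inv_cancel]
  have hv3 : (z * x⁻¹) ^ 3 = 1 := by rw [mul_pow, inv_pow, hx.2, hz.2, mul_inv_cancel]
  have hw1 : y * x⁻¹ ≠ 1 := fun h => hxy (mul_inv_eq_one.1 h).symm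
  have hv1 : z * x⁻¹ ≠ 1 := fun h => hxz (mul_inv_eq_one.1 h).symm
  have hwv : y * x⁻¹ ≠ z * x⁻¹ := fun h => hyz (mul_right_cancel h)
  set w := y * x⁻¹ with hw
  have hw2 : w ^ 2 ≠ 1 := fun h => hw1 (by simpa [pow_succ, h] using hw3)
  have hww : w ^ 2 ≠ w := fun h => hw1 (by simpa [pow_two] using h)
  have hz2 : z * x⁻¹ = w ^ 2 := by
    by_contra hne
    have hsub : ({1, w, w ^ 2, z * x⁻¹} : Finset H) ⊆
        (((powMonoidHom 3 : H →* H).ker : Set H)).toFinset := by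
      intro g hg
      simp only [Finset.mem_insert, Finset.mem_singleton] at hg
      simp only [Set.mem_toFinset, SetLike.mem_coe, MonoidHom.mem_ker, powMonoidHom_apply]
      rcases hg with rfl | rfl | rfl | rfl
      · simp
      · exact hw3
      · rw [← pow_mul, mul_comm, pow_mul, hw3, one_pow]
      · exact hv3
    have hc := Finset.card_le_card hsub
    have h4 : #({1, w, w ^ 2, z * x⁻¹} : Finset H) = 4 := by
      rw [Finset.card_insert_of_notMem, Finset.card_insert_of_notMem, Finset.card_insert_of_notMem,
        Finset.card_singleton]
      · simpa using Ne.symm hne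
      · simpa using ⟨hww.symm, hwv⟩
      · simpa using ⟨hw1.symm, hw2.symm, hv1.symm⟩
    rw [h4, Set.toFinset_card, ← Nat.card_eq_fintype_card] at hc
    exact absurd (hc.trans hK) (by norm_num)
  have hyx : y = w * x := by rw [hw]; simp
  have hzx : z = w ^ 2 * x := by rw [← hz2]; simp
  have h3 : 2 < #{p ∈ B ×ˢ B | p.1 * p.2 = w} := by
    refine Finset.two_lt_card_iff.2 ⟨(y, x⁻¹), (z, y⁻¹), (x, z⁻¹), ?_, ?_, ?_, ?_, ?_, ?_⟩
    · simp [hy.1, hBinv x hx.1, hw]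
    · simp only [Finset.mem_filter, Finset.mem_product, hz.1, hBinv y hy.1, true_and]
      rw [hzx, hyx, mul_inv, mul_mul_mul_comm, mul_inv_cancel, pow_two]
      simp
    · simp only [Finset.mem_filter, Finset.mem_product, hx.1, hBinv z hz.1, true_and]
      rw [hzx, mul_inv, mul_left_comm, mul_inv_cancel, mul_one, inv_eq_iff_mul_eq_one, ← pow_succ]
      exact hw3
    · simp [hyz]
    · simp [hxy.symm]
    · simp [hxz.symm]
  have := hsq w
  rw [if_neg hw1] at this
  omega

end Pairs

theorem coefficient_inequalities (c a : ℕ) (p q : Prop) [Decidable p] [Decidable q]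
    (hpq : p → ¬q) (ha : a ≤ 2)
    (hmod : (c + a) % 3 = ((if p then 1 else 0) + 2 * (if q then 1 else 0)) % 3)
    (i j u v d e y₃ y₀ : ℤ) (hi : i = if p then 1 else 0) (hj : j = if q then 1 else 0)
    (hu : u = if p ∧ 0 < a then 1 else 0) (hv : v = if q ∧ 0 < a then 1 else 0)
    (hd : d = if a = 2 ∧ q then 1 else 0) (he : e = if a = 2 ∧ ¬(p ∨ q) then 1 else 0)
    (hy₃ : y₃ = if c = 3 then 1 else 0) (hy₀ : y₀ = if c = 0 then 1 else 0) :
    5 * c - c ^ 2 - 6 * (i + j + a) + 6 * (2 * u + v + 2 * d + e) ≤ 6 * y₃ ∧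
    3 * y₃ ≤ c - (i + 2 * j + 2 * a) + 3 * (u + v + d + e) ∧
    6 + 7 * c - 3 * c ^ 2 + 2 * (i + 2 * j + 2 * a) - 6 * (u + v + d + e)
      - 12 * (i + j + a) + 12 * (2 * u + v + 2 * d + e) ≤ 6 * y₀ ∧
    6 * y₀ ≤ 6 - 5 * c + c ^ 2 := by
  have key : (c = 0 ∨ c = 3) ∨ (c = 1 ∨ c = 2 ∨ c = 4 ∨ c = 5) ∨ 6 ≤ c := by omega
  have hbound : 6 ≤ c → (6 : ℤ) * c ≤ c ^ 2 := fun h => by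
    have : (6 : ℤ) ≤ c := by exact_mod_cast h
    nlinarith
  have hc6 : 6 ≤ c → c ≠ 3 ∧ c ≠ 0 := fun h => by omega
  by_cases hp : p <;> by_cases hq : q <;> [exact absurd hq (hpq hp); skip; skip; skip] <;>
    interval_cases a <;> simp only [hp, hq] at * <;> simp at * <;> subst_vars <;>
    rcases key with (rfl | rfl) | (rfl | rfl | rfl | rfl) | h6 <;> simp at * <;>
    (try simp [hc6 h6]) <;> (try have := hbound h6) <;> (try refine ⟨?_, ?_, ?_, ?_⟩) <;> omega

/-- For `n ≡ 1 (mod 6)`, bounds on `|Y₃|` and `|Y₀|` in terms of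
`u₀ = |T₁⁽³⁾ ∩ T₀|`, `u₁ = |T₁⁽³⁾ ∩ T₁|`, `Δ₁¹ = Δ₁ ∩ T₁`, `Δ₁² = Δ₁ ∖ (T₀ ∪ T₁)`
and `θ₁`, as inequalities of rational numbers. -/
theorem Y3_Y0_bounds_n_eq_one_mod_six (n : ℕ) (hn : 0 < n) (hmod : n % 6 = 1)
    {H : Type*} [CommGroup H] [Fintype H]
    (hcard : Fintype.card H = n ^ 2 + n + 1)
    (T₀ T₁ : Set H) (hT₀inv : T₀⁻¹ = T₀) (hT₁inv : T₁⁻¹ = T₁)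
    (he : (1 : H) ∈ T₀) (hk : T₀.ncard + T₁.ncard = 2 * n + 1)
    (hAPLL : APLLEqs n T₀ T₁)
    (u₀ u₁ d₁ d₂ : ℕ)
    (hu₀ : u₀ = (T₀ ∩ ((fun t => t ^ 3) '' T₁)).ncard)
    (hu₁ : u₁ = (T₁ ∩ ((fun t => t ^ 3) '' T₁)).ncard)
    (hd₁ : d₁ = ({h : H | {t : H | t ∈ T₁ ∧ t ^ 3 = h}.ncard = 2} ∩ T₁).ncard)
    (hd₂ : d₂ = ({h : H | {t : H | t ∈ T₁ ∧ t ^ 3 = h}.ncard = 2} \ (T₀ ∪ T₁)).ncard) :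
    (2 * (n : ℚ) ^ 2 - 5 * n - 4 + theta1 T₀ T₁
        + 3 * (2 * u₀ + u₁ + 2 * d₁ + d₂) ≤ 3 * ((Yset T₀ T₁ 3).ncard : ℚ) ∧
      3 * ((Yset T₀ T₁ 3).ncard : ℚ)
        ≤ 2 * (n : ℚ) ^ 2 - 2 * n - 3 + 3 * (u₀ + u₁ + d₁ + d₂)) ∧
    ((n : ℚ) ^ 2 - 10 * n - 3 - 3 * (u₀ + u₁ + d₁ + d₂) + 3 * theta1 T₀ T₁
        ≤ 3 * ((Yset T₀ T₁ 0).ncard : ℚ) ∧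
      3 * ((Yset T₀ T₁ 0).ncard : ℚ) ≤ (n : ℚ) ^ 2 - n + 1 - theta1 T₀ T₁) := by
  obtain ⟨A, rfl⟩ : ∃ A : Finset H, T₀ = A := ⟨T₀.toFinset, by simp⟩
  obtain ⟨B, rfl⟩ : ∃ B : Finset H, T₁ = B := ⟨T₁.toFinset, by simp⟩
  have hAinv : ∀ x ∈ A, x⁻¹ ∈ A := fun x hx => by
    have : x⁻¹ ∈ (A : Set H)⁻¹ := by simpa using hx
    rwa [hT₀inv] at this
  have hBinv : ∀ x ∈ B, x⁻¹ ∈ B := fun x hx => by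
    have : x⁻¹ ∈ (B : Set H)⁻¹ := by simpa using hx
    rwa [hT₁inv] at this
  have hset {α : Type _} [Fintype α] (P : α → Prop) : {x | P x}.ncard = #{x | P x} := by
    rw [← Set.ncard_coe_finset]
    simp
  have hprod (S T : Finset H) (f : H × H → H) (h : H) :
      {p : H × H | p.1 ∈ (S : Set H) ∧ p.2 ∈ (T : Set H) ∧ f p = h}.ncard
        = #{p ∈ S ×ˢ T | f p = h} := by
    rw [← Set.ncard_coe_finset]
    congr 1
    ext p
    simp [and_assoc]
  have hsub (S : Finset H) (k : ℕ) (h : H) :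
      {t : H | t ∈ (S : Set H) ∧ t ^ k = h}.ncard = #{t ∈ S | t ^ k = h} := by
    rw [← Set.ncard_coe_finset]
    congr 1
    ext t
    simp
  obtain ⟨h01, hsq⟩ := hAPLL
  simp only [hprod, hsub] at h01 hsq hd₁ hd₂
  have h1A : (1 : H) ∈ A := by simpa using he
  have hd := disjoint_of_card_mul_eq hBinv h01
  have h1B : (1 : H) ∉ B := Finset.disjoint_left.1 hd h1A
  have hinj : Function.Injective fun x : H => x ^ 2 := by
    have hc : (Nat.card H).Coprime 2 := by
      rw [Nat.card_eq_fintype_card, hcard, Nat.coprime_two_right, pow_two,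
        show n * n + n = n * (n + 1) by ring]
      exact (Nat.even_mul_succ_self n).add_one
    exact (powCoprime hc).injective
  have hAB := card_mul_card hcard h01
  rw [Set.ncard_coe_finset, Set.ncard_coe_finset] at hk
  have hBe := even_card_of_inv_mem hinj hBinv h1B
  have hB : #B = n + 1 := by
    have hprod0 : ((#B : ℤ) - n) * (#B - (n + 1)) = 0 := by
      have h1 : (#A : ℤ) = 2 * n + 1 - #B := by
        have : (#A + #B : ℤ) = 2 * n + 1 := by exact_mod_cast hk
        linarith
      have h2 : (#A * #B : ℤ) = n * (n + 1) := by exact_mod_cast hAB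
      rw [h1] at h2
      linear_combination -h2
    rcases mul_eq_zero.1 hprod0 with h | h
    · have : #B = n := by omega
      obtain ⟨k, hk⟩ := hBe
      omega
    · omega
  have hA : #A = n := by omega
  have hmod3 := card_sq_mul_cast_zmod_three hd (by omega) hA hB h01 hsq
  have hsecond := sum_card_sq_mul_sq hinj hAinv hBinv h1A hB h01 hsq
  have hle := card_cube_eq_le_two hcard hBinv hsq
  have hfirst : ∑ h : H, #{p ∈ (A ∪ B) ×ˢ B | p.1 ^ 2 * p.2 = h} = (2 * n + 1) * (n + 1) := by
    rw [← Finset.card_eq_sum_card_fiberwise (f := fun p : H × H => p.1 ^ 2 * p.2) (t := univ)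
      (by simp), Finset.card_product, Finset.card_union_of_disjoint hd, hB, hk.symm, hB]
  have hcube : ∑ h : H, #{t ∈ B | t ^ 3 = h} = n + 1 := by
    rw [← Finset.card_eq_sum_card_fiberwise (f := fun t : H => t ^ 3) (t := univ) (by simp), hB]
  have hcubemem (h : H) : h ∈ (fun t => t ^ 3) '' (B : Set H) ↔ 0 < #{t ∈ B | t ^ 3 = h} := by
    simp [Finset.card_pos, Finset.Nonempty]
  have hcount (S : Set H) (P : H → Prop) [DecidablePred P] (hS : ∀ h, h ∈ S ↔ P h) :
      (S.ncard : ℤ) = ∑ h : H, if P h then 1 else 0 := by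
    rw [show S = {h | P h} from Set.ext hS, hset]
    simp only [Finset.sum_boole]
    congr!
  have hsumA : ∑ h : H, (if h ∈ A then 1 else 0 : ℤ) = n := by simp [hA]
  have hsumB : ∑ h : H, (if h ∈ B then 1 else 0 : ℤ) = n + 1 := by simp [hB]
  have hsumu := hcount ((A : Set H) ∩ ((fun t => t ^ 3) '' (B : Set H)))
    (fun h => h ∈ A ∧ 0 < #{t ∈ B | t ^ 3 = h}) fun h => and_congr Iff.rfl (hcubemem h)
  have hsumv := hcount ((B : Set H) ∩ ((fun t => t ^ 3) '' (B : Set H)))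
    (fun h => h ∈ B ∧ 0 < #{t ∈ B | t ^ 3 = h}) fun h => and_congr Iff.rfl (hcubemem h)
  have hsumd := hcount ({h : H | #{t ∈ B | t ^ 3 = h} = 2} ∩ (B : Set H))
    (fun h => #{t ∈ B | t ^ 3 = h} = 2 ∧ h ∈ B) fun _ => Iff.rfl
  have hsume := hcount ({h : H | #{t ∈ B | t ^ 3 = h} = 2} \ ((A : Set H) ∪ B))
    (fun h => #{t ∈ B | t ^ 3 = h} = 2 ∧ ¬(h ∈ A ∨ h ∈ B)) fun _ => Iff.rfl
  have hY (i : ℕ) := hcount (Yset (A : Set H) B i)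
    (fun h => #{p ∈ (A ∪ B) ×ˢ B | p.1 ^ 2 * p.2 = h} = i) fun h => by
      rw [← hprod, Finset.coe_union]; rfl
  have hsum3 := hY 3
  have hsum0 := hY 0
  rw [← hu₀] at hsumu
  rw [← hu₁] at hsumv
  rw [← hd₁] at hsumd
  rw [← hd₂] at hsume
  have hpoint (h : H) := coefficient_inequalities _ _ (h ∈ A) (h ∈ B)
    (fun hp => Finset.disjoint_left.1 hd hp) (hle h) (hmod3 h) _ _ _ _ _ _ _ _
    rfl rfl rfl rfl rfl rfl rfl rfl
  have hfirst' : ∑ h : H, (#{p ∈ (A ∪ B) ×ˢ B | p.1 ^ 2 * p.2 = h} : ℤ)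
      = (2 * n + 1) * (n + 1) := by exact_mod_cast hfirst
  have hcube' : ∑ h : H, (#{t ∈ B | t ^ 3 = h} : ℤ) = n + 1 := by exact_mod_cast hcube
  have hone : ∑ _h : H, (6 : ℤ) = 6 * (n ^ 2 + n + 1) := by
    simp [hcard, mul_comm]
  have hθ : (2 : ℚ) * theta1 (A : Set H) B
      = ((#(B ∩ (A ∪ B).image (· ^ 2))
        + 2 * #(((B * B) \ (B.image (· ^ 2) ∪ {1})) ∩ (A ∪ B).image (· ^ 4)) : ℤ) : ℚ) := by
    have e1 : (B : Set H) ∩ (fun g => g ^ 2) '' ((A : Set H) ∪ B)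
        = ((B ∩ (A ∪ B).image (· ^ 2) : Finset H) : Set H) := by push_cast; rfl
    have e2 : (((B : Set H) * B) \ (((fun t => t ^ 2) '' (B : Set H)) ∪ {1}))
        ∩ ((fun g => g ^ 4) '' ((A : Set H) ∪ B))
        = ((((B * B) \ (B.image (· ^ 2) ∪ {1})) ∩ (A ∪ B).image (· ^ 4) : Finset H) : Set H) := by
      push_cast; rfl
    rw [theta1, e1, e2, Set.ncard_coe_finset, Set.ncard_coe_finset]
    push_cast
    ring
  set m : ℤ := #(B ∩ (A ∪ B).image (· ^ 2))
        + 2 * #(((B * B) \ (B.image (· ^ 2) ∪ {1})) ∩ (A ∪ B).image (· ^ 4)) with hm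
  have q1 := Finset.sum_le_sum fun h (_ : h ∈ univ) => (hpoint h).1
  have q2 := Finset.sum_le_sum fun h (_ : h ∈ univ) => (hpoint h).2.1
  have q3 := Finset.sum_le_sum fun h (_ : h ∈ univ) => (hpoint h).2.2.1
  have q4 := Finset.sum_le_sum fun h (_ : h ∈ univ) => (hpoint h).2.2.2
  simp only [Finset.sum_add_distrib, Finset.sum_sub_distrib, ← Finset.mul_sum, hsumA, hsumB,
    ← hsumu, ← hsumv, ← hsumd, ← hsume, ← hsum3, ← hsum0, hfirst', hcube', hone, hsecond]
    at q1 q2 q3 q4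
  have hθ' : theta1 (A : Set H) B = m / 2 := by linarith
  rw [hθ']
  have r1 : 4 * (n : ℤ) ^ 2 - 10 * n - 8 + m + 6 * (2 * u₀ + u₁ + 2 * d₁ + d₂)
      ≤ 6 * (Yset (A : Set H) B 3).ncard := by linarith
  have r2 : 3 * ((Yset (A : Set H) B 3).ncard : ℤ)
      ≤ 2 * (n : ℤ) ^ 2 - 2 * n - 3 + 3 * (u₀ + u₁ + d₁ + d₂) := by linarith
  have r3 : 2 * (n : ℤ) ^ 2 - 20 * n - 6 - 6 * (u₀ + u₁ + d₁ + d₂) + 3 * m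
      ≤ 6 * (Yset (A : Set H) B 0).ncard := by
    have h0 : (0 : ℤ) ≤ 2 * u₀ + u₁ + 2 * d₁ + d₂ := by positivity
    linarith
  have r4 : 6 * ((Yset (A : Set H) B 0).ncard : ℤ) ≤ 2 * (n : ℤ) ^ 2 - 2 * n + 2 - m := by
    linarith
  qify at r1 r2 r3 r4
  refine ⟨⟨?_, ?_⟩, ?_, ?_⟩ <;> linarith
end

section
/- Let n be a positive integer with n ≡ 5 (mod 6), H a finite abelian group of order n²+n+1, and T₀, T₁ inverse-closed subsets of H with e ∈ T₀ and |T₀| + |T₁| = 2n+1 satisfying the APLL group-ring equations. Let ℓ₀ = |T₁ ∩ {t³ : t ∈ T₀}|, and for i ≥ 5 let s_i = (i−1)(i−4)/2 if i ≡ 1 (mod 3) and s_i = (i−2)(i−3)/2 otherwise. Then: 3|X₀| ≤ n − 2ℓ₀ + 1 − θ₀; Σ_{i≥5} s_i·|X_i| ≤ n − 2ℓ₀ + 1 − θ₀; 2n² − 4n + 7ℓ₀ + 3 + 2θ₀ ≤ 3|X₁| ≤ 2n² − ℓ₀ + 7 − 2θ₀; and n² − 6n + 7ℓ₀ − 1 +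 2θ₀ ≤ 3|X₄| ≤ n² − 3n + ℓ₀ + 2 − θ₀. -/
open scoped Classical Pointwise

section PowerSums

variable {H : Type*} [CommGroup H] [Fintype H] {R : Type*} [CommRing R]

/-- `powSum R k S` is the group-ring element `∑_{s ∈ S} s ^ k`, denoted `S^{(k)}`. -/
noncomputable def powSum (R : Type*) [CommRing R] (k : ℕ) (S : Set H) : MonoidAlgebra R H :=
  ∑ s with s ∈ S, MonoidAlgebra.single (s ^ k) 1

theorem coeff_powSum (k : ℕ) (S : Set H) (h : H) :
    (powSum R k S).coeff h = (({s : H | s ∈ S ∧ s ^ k = h}.ncard : ℕ) : R) := by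
  rw [powSum, MonoidAlgebra.coeff_sum, Finset.sum_apply']
  simp only [MonoidAlgebra.coeff_single, Finsupp.single_apply, Finset.sum_boole,
    Finset.filter_filter]
  rw [Set.ncard_eq_toFinset_card']
  congr 2
  ext; simp

theorem coeff_powSum_mul_powSum (k l : ℕ) (A B : Set H) (h : H) :
    (powSum R k A * powSum R l B).coeff h =
      (({p : H × H | p.1 ∈ A ∧ p.2 ∈ B ∧ p.1 ^ k * p.2 ^ l = h}.ncard : ℕ) : R) := by
  rw [powSum, powSum, Finset.sum_mul_sum, ← Finset.sum_product', MonoidAlgebra.coeff_sum,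
    Finset.sum_apply']
  simp only [MonoidAlgebra.single_mul_single, mul_one, MonoidAlgebra.coeff_single,
    Finsupp.single_apply, Finset.sum_boole]
  rw [Set.ncard_eq_toFinset_card']
  congr 2
  ext; simp [and_assoc]

theorem coeff_powSum_mul (k : ℕ) (A : Set H) (x : MonoidAlgebra R H) (h : H) :
    (powSum R k A * x).coeff h = ∑ a with a ∈ A, x.coeff ((a ^ k)⁻¹ * h) := by
  rw [powSum, Finset.sum_mul, MonoidAlgebra.coeff_sum, Finset.sum_apply']
  simp [MonoidAlgebra.coeff_single_mul_apply]

theorem coeff_powSum_univ (h : H) : (powSum R 1 (Set.univ : Set H)).coeff h = 1 := by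
  rw [coeff_powSum]
  simp

omit [Fintype H] in
theorem coeff_natCast (m : ℕ) (h : H) :
    (m : MonoidAlgebra R H).coeff h = if h = 1 then (m : R) else 0 := by
  rw [← nsmul_one, MonoidAlgebra.coeff_smul, Finsupp.smul_apply, MonoidAlgebra.one_def,
    MonoidAlgebra.coeff_single, Finsupp.single_apply]
  simp [eq_comm]

omit [Fintype H] in
theorem coeff_natCast_mul (m : ℕ) (x : MonoidAlgebra R H) (h : H) :
    ((m : MonoidAlgebra R H) * x).coeff h = m * x.coeff h := by
  rw [← nsmul_eq_mul, MonoidAlgebra.coeff_smul, Finsupp.smul_apply, nsmul_eq_mul]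

theorem powSum_mul_univ (k : ℕ) (S : Set H) :
    powSum R k S * powSum R 1 Set.univ = (S.ncard : MonoidAlgebra R H) * powSum R 1 Set.univ := by
  ext h
  rw [coeff_natCast_mul, coeff_powSum_mul]
  simp [coeff_powSum_univ, Set.ncard_eq_toFinset_card']

theorem powSum_union {A B : Set H} (hAB : Disjoint A B) (k : ℕ) :
    powSum R k (A ∪ B) = powSum R k A + powSum R k B := by
  unfold powSum
  rw [← Finset.sum_union (by
    rw [Finset.disjoint_filter]
    exact fun x _ hA hB => Set.disjoint_left.mp hAB hA hB)]
  congr 1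
  ext; simp

theorem mapDomain_powSum (k m : ℕ) (S : Set H) :
    MonoidAlgebra.mapDomainRingHom R (powMonoidHom k : H →* H) (powSum R m S) =
      powSum R (m * k) S := by
  simp [powSum, map_sum, pow_mul]

theorem coeff_powSum_of_coprime {k : ℕ} (hk : (Nat.card H).Coprime k) (S : Set H) (h : H) :
    (powSum R k S).coeff h = if h ∈ (fun s => s ^ k) '' S then 1 else 0 := by
  rw [coeff_powSum]
  split_ifs with hS
  · obtain ⟨s, hs, rfl⟩ := hS
    have : {t : H | t ∈ S ∧ t ^ k = s ^ k} = {s} := by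
      ext t
      exact ⟨fun ht => (powCoprime hk).injective ht.2, by rintro rfl; exact ⟨hs, rfl⟩⟩
    simp [this]
  · have : {t : H | t ∈ S ∧ t ^ k = h} = ∅ :=
      Set.eq_empty_of_forall_notMem fun t ht => hS ⟨t, ht⟩
    simp [this]

theorem powSum_two_univ (hH : (Nat.card H).Coprime 2) :
    powSum R 2 (Set.univ : Set H) = powSum R 1 Set.univ := by
  simp only [powSum]
  exact Finset.sum_bij (fun h _ => h ^ 2) (by simp)
    (fun a _ b _ hab => (powCoprime hH).injective hab)
    (fun b _ => ⟨(powCoprime hH).symm b, by simp, (powCoprime hH).apply_symm_apply b⟩) (by simp)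

theorem powSum_one_pow_char (p : ℕ) [Fact p.Prime] [CharP R p] (S : Set H) :
    powSum R 1 S ^ p = powSum R p S := by
  have : CharP (MonoidAlgebra R H) p := by
    exact charP_of_injective_ringHom
      (f := (MonoidAlgebra.singleOneRingHom : R →+* MonoidAlgebra R H))
      MonoidAlgebra.single_right_injective p
  rw [powSum, sum_pow_char]
  simp [powSum]

end PowerSums

theorem MonoidAlgebra.coeff_mul_one_eq_sum {R G : Type*} [CommRing R] [Group G] [Fintype G]
    (x y : MonoidAlgebra R G) : (x * y).coeff 1 = ∑ g, x.coeff g * y.coeff g⁻¹ := by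
  rw [MonoidAlgebra.coeff_mul_antidiag x y 1 (Finset.univ.image fun g : G => (g, g⁻¹)),
    Finset.sum_image (fun _ _ _ _ h => congrArg Prod.fst h)]
  rintro ⟨a, b⟩
  simp [mul_eq_one_iff_eq_inv', eq_comm]

section APLL

variable {H : Type*} [CommGroup H] [Fintype H] {R : Type*} [CommRing R]
  {n : ℕ} {T₀ T₁ : Set H}

theorem APLLEqs.powSum_mul_powSum (hA : APLLEqs n T₀ T₁) :
    powSum R 1 T₀ * powSum R 1 T₁ = powSum R 1 Set.univ - 1 := by
  rw [eq_sub_iff_add_eq, ← Nat.cast_one (R := MonoidAlgebra R H)]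
  ext h
  rw [MonoidAlgebra.coeff_add, Finsupp.add_apply, coeff_powSum_mul_powSum, coeff_powSum_univ,
    coeff_natCast]
  simp only [pow_one]
  rw [hA.1 h]
  split_ifs <;> simp

theorem APLLEqs.powSum_sq_add_powSum_sq (hA : APLLEqs n T₀ T₁) :
    powSum R 1 T₀ ^ 2 + powSum R 1 T₁ ^ 2 + powSum R 2 T₀ + powSum R 2 T₁ =
      2 * powSum R 1 Set.univ + ((2 * n : ℕ) : MonoidAlgebra R H) := by
  ext h
  rw [sq, sq, two_mul]
  simp only [MonoidAlgebra.coeff_add, Finsupp.add_apply, coeff_powSum_mul_powSum,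
    coeff_natCast, coeff_powSum, pow_one, ← Nat.cast_add]
  rw [hA.2 h]
  split_ifs <;> simp [one_add_one_eq_two]

theorem APLLEqs.disjoint_s6 (hA : APLLEqs n T₀ T₁) (hT₀inv : T₀⁻¹ = T₀) : Disjoint T₀ T₁ := by
  rw [Set.disjoint_left]
  intro t h₀ h₁
  have h := hA.1 1
  rw [if_pos rfl, Set.ncard_eq_zero] at h
  have : (t⁻¹, t) ∈ ({p : H × H | p.1 ∈ T₀ ∧ p.2 ∈ T₁ ∧ p.1 * p.2 = 1}) :=
    ⟨by rw [← hT₀inv]; simpa using h₀, h₁, by simp⟩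
  simp [h] at this

theorem APLLEqs.ncard_mul_ncard_s6 (hA : APLLEqs n T₀ T₁) :
    T₀.ncard * T₁.ncard + 1 = Fintype.card H := by
  have h := congrArg (· * powSum ℤ 1 Set.univ) (hA.powSum_mul_powSum (R := ℤ))
  simp only [sub_mul, powSum_mul_univ, mul_assoc, one_mul] at h
  rw [mul_left_comm, powSum_mul_univ, eq_sub_iff_add_eq] at h
  have hcoeff := congrArg (fun x => x.coeff 1) h
  simp only [MonoidAlgebra.coeff_add, Finsupp.add_apply, coeff_natCast_mul, coeff_powSum_univ,
    Set.ncard_univ, Nat.card_eq_fintype_card, mul_one] at hcoeff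
  rw [mul_comm]
  exact_mod_cast hcoeff

/-- An inverse-closed subset containing `1` of a group of odd order has odd cardinality. -/
theorem odd_ncard_of_inv_eq_s6 (hH : (Nat.card H).Coprime 2) {S : Set H} (hS : S⁻¹ = S)
    (h1 : (1 : H) ∈ S) : Odd S.ncard := by
  have hsum : ∑ s ∈ S.toFinset.erase 1, (1 : ZMod 2) = 0 := by
    refine Finset.sum_involution (fun s _ => s⁻¹) ?_ ?_ ?_ ?_
    · intros; decide
    · intro s hs _ hinv
      refine (Finset.ne_of_mem_erase hs) ((powCoprime hH).injective ?_)
      simp only [powCoprime_apply, sq]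
      nth_rewrite 1 [← hinv]
      simp
    · intro s hs
      simp only [Finset.mem_erase, Set.mem_toFinset, ne_eq, inv_eq_one] at hs ⊢
      exact ⟨hs.1, by rw [← hS]; simpa using hs.2⟩
    · simp
  rw [Finset.sum_const, nsmul_one, ZMod.natCast_eq_zero_iff_even,
    Finset.card_erase_of_mem (by simpa using h1)] at hsum
  rw [Set.ncard_eq_toFinset_card']
  have : 0 < S.toFinset.card := Finset.card_pos.mpr ⟨1, by simpa using h1⟩
  obtain ⟨m, hm⟩ := hsum
  exact ⟨m, by omega⟩

/-- The polynomial identity obtained by multiplying the second APLL equation by `T₀`. -/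
theorem APLLEqs.powSum_two_mul (hA : APLLEqs n T₀ T₁) (hd : Disjoint T₀ T₁)
    (h₀ : T₀.ncard = n) (h₁ : T₁.ncard = n + 1) :
    powSum R 2 (T₀ ∪ T₁) * powSum R 1 T₀ + powSum R 1 T₀ ^ 3 + powSum R 1 Set.univ =
      (n : MonoidAlgebra R H) * powSum R 1 Set.univ + powSum R 1 T₁ +
        ((2 * n : ℕ) : MonoidAlgebra R H) * powSum R 1 T₀ := by
  have e1 := hA.powSum_mul_powSum (R := R)
  have e2 := hA.powSum_sq_add_powSum_sq (R := R)
  have u0 := powSum_mul_univ (R := R) 1 T₀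
  have u1 := powSum_mul_univ (R := R) 1 T₁
  rw [h₀] at u0
  rw [h₁] at u1
  rw [powSum_union hd]
  push_cast at *
  linear_combination powSum R 1 T₀ * e2 - powSum R 1 T₁ * e1 + 2 * u0 - u1

theorem APLLEqs.powSum_union_sq (hA : APLLEqs n T₀ T₁) (hd : Disjoint T₀ T₁) :
    powSum R 1 (T₀ ∪ T₁) ^ 2 + powSum R 2 (T₀ ∪ T₁) + 2 =
      4 * powSum R 1 Set.univ + ((2 * n : ℕ) : MonoidAlgebra R H) := by
  rw [powSum_union hd, powSum_union hd]
  linear_combination 2 * hA.powSum_mul_powSum (R := R) + hA.powSum_sq_add_powSum_sq (R := R)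

theorem APLLEqs.powSum_two_union_sq (hA : APLLEqs n T₀ T₁) (hd : Disjoint T₀ T₁)
    (hH : (Nat.card H).Coprime 2) :
    powSum R 2 (T₀ ∪ T₁) ^ 2 + powSum R 4 (T₀ ∪ T₁) + 2 =
      4 * powSum R 1 Set.univ + ((2 * n : ℕ) : MonoidAlgebra R H) := by
  have h := congrArg (MonoidAlgebra.mapDomainRingHom R (powMonoidHom 2 : H →* H))
    (hA.powSum_union_sq (R := R) hd)
  simpa only [map_add, map_mul, map_pow, mapDomain_powSum, map_natCast, map_ofNat, one_mul,
    powSum_two_univ hH] using h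

theorem APLLEqs.sq_powSum_two_mul (hA : APLLEqs n T₀ T₁) (hd : Disjoint T₀ T₁)
    (hH : (Nat.card H).Coprime 2) (h₀ : T₀.ncard = n) :
    (powSum R 2 (T₀ ∪ T₁) * powSum R 1 T₀) * (powSum R 2 (T₀ ∪ T₁) * powSum R 1 T₀) +
        powSum R 4 (T₀ ∪ T₁) * (powSum R 1 T₀ * powSum R 1 T₀) +
        2 • (powSum R 1 T₀ * powSum R 1 T₀) =
      (4 * n ^ 2) • powSum R 1 Set.univ + (2 * n) • (powSum R 1 T₀ * powSum R 1 T₀) := by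
  have u0 := powSum_mul_univ (R := R) 1 T₀
  rw [h₀] at u0
  have e := hA.powSum_two_union_sq (R := R) hd hH
  simp only [nsmul_eq_mul]
  push_cast at *
  linear_combination powSum R 1 T₀ ^ 2 * e + (4 * powSum R 1 T₀ + 4 * (n : MonoidAlgebra R H)) * u0

omit [Fintype H] in
theorem ncard_mul_eq_inv {A B : Set H} (hA : A⁻¹ = A) (hB : B⁻¹ = B) (k l : ℕ) (h : H) :
    {p : H × H | p.1 ∈ A ∧ p.2 ∈ B ∧ p.1 ^ k * p.2 ^ l = h⁻¹}.ncard =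
      {p : H × H | p.1 ∈ A ∧ p.2 ∈ B ∧ p.1 ^ k * p.2 ^ l = h}.ncard := by
  rw [← Set.ncard_image_of_injective _ (inv_injective (G := H × H)), Set.image_inv_eq_inv]
  congr 1
  ext ⟨a, b⟩
  have ha : a⁻¹ ∈ A ↔ a ∈ A := by rw [← Set.mem_inv, hA]
  have hb : b⁻¹ ∈ B ↔ b ∈ B := by rw [← Set.mem_inv, hB]
  simp [ha, hb, ← mul_inv, -mul_inv_rev]

/-- Distinct factorizations over `T₀` of a non-identity element exclude it from `T̂^{(2)}`. -/
theorem APLLEqs.eq_of_mul_eq_sq (hA : APLLEqs n T₀ T₁) {a b c d s : H} (ha : a ∈ T₀) (hb : b ∈ T₀)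
    (hc : c ∈ T₀) (hd : d ∈ T₀) (hs : s ∈ T₀ ∪ T₁) (hs1 : s ^ 2 ≠ 1) (hab : a * b = s ^ 2)
    (hcd : c * d = s ^ 2) : a = c := by
  by_contra hac
  have h := hA.2 (s ^ 2)
  rw [if_neg hs1] at h
  have h2 : 1 < {p : H × H | p.1 ∈ T₀ ∧ p.2 ∈ T₀ ∧ p.1 * p.2 = s ^ 2}.ncard :=
    (Set.one_lt_ncard (Set.toFinite _)).mpr
      ⟨(a, b), ⟨ha, hb, hab⟩, (c, d), ⟨hc, hd, hcd⟩, fun e => hac (congrArg Prod.fst e)⟩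
  rcases hs with hs | hs
  · have : 0 < {t : H | t ∈ T₀ ∧ t ^ 2 = s ^ 2}.ncard :=
      (Set.ncard_pos (Set.toFinite _)).mpr ⟨s, hs, rfl⟩
    omega
  · have : 0 < {t : H | t ∈ T₁ ∧ t ^ 2 = s ^ 2}.ncard :=
      (Set.ncard_pos (Set.toFinite _)).mpr ⟨s, hs, rfl⟩
    omega

omit [Fintype H] in
theorem sq_eq_one_iff_of_coprime (hH : (Nat.card H).Coprime 2) {s : H} : s ^ 2 = 1 ↔ s = 1 :=
  ⟨fun h => (powCoprime hH).injective (by simpa using h), by rintro rfl; simp⟩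

/-- `T₀ ∩ T̂^{(2)} = {e}`. -/
theorem APLLEqs.eq_one_of_sq_mem (hA : APLLEqs n T₀ T₁) (hH : (Nat.card H).Coprime 2)
    (he : (1 : H) ∈ T₀) {s : H} (hs : s ∈ T₀ ∪ T₁) (hs2 : s ^ 2 ∈ T₀) : s = 1 := by
  by_contra hs1
  have hs1 : s ^ 2 ≠ 1 := (sq_eq_one_iff_of_coprime hH).not.mpr hs1
  exact hs1 (hA.eq_of_mul_eq_sq hs2 he he hs2 hs hs1 (mul_one _) (one_mul _))

/-- `T₀ ∩ T₀^{(3)} = {e}`. -/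
theorem APLLEqs.eq_one_of_cube_mem (hA : APLLEqs n T₀ T₁) (hH : (Nat.card H).Coprime 2)
    (hT₀inv : T₀⁻¹ = T₀) {s : H} (hs : s ∈ T₀) (hs3 : s ^ 3 ∈ T₀) : s = 1 := by
  by_contra hs1
  have hs1 : s ^ 2 ≠ 1 := (sq_eq_one_iff_of_coprime hH).not.mpr hs1
  have h := hA.eq_of_mul_eq_sq hs3 (d := s) (c := s) (b := s⁻¹) (by rw [← hT₀inv]; simpa using hs)
    hs hs (Or.inl hs) hs1 (by group) (sq s).symm
  exact hs1 (by simpa [pow_succ] using h)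

theorem APLLEqs.ncard_mul_eq (hA : APLLEqs n T₀ T₁) {h : H} (hh : h ∈ T₀ * T₀)
    (hh' : h ∉ (fun t => t ^ 2) '' T₀) (h1 : h ≠ 1) :
    {p : H × H | p.1 ∈ T₀ ∧ p.2 ∈ T₀ ∧ p.1 * p.2 = h}.ncard = 2 := by
  obtain ⟨a, ha, b, hb, hab'⟩ := hh
  change a * b = h at hab'
  subst hab'
  have hab : a ≠ b := by
    rintro rfl
    exact hh' ⟨a, ha, sq a⟩
  have h := hA.2 (a * b)
  rw [if_neg h1] at h
  have h2 : 1 < {p : H × H | p.1 ∈ T₀ ∧ p.2 ∈ T₀ ∧ p.1 * p.2 = a * b}.ncard :=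
    (Set.one_lt_ncard (Set.toFinite _)).mpr
      ⟨(a, b), ⟨ha, hb, rfl⟩, (b, a), ⟨hb, ha, mul_comm _ _⟩, fun e => hab (congrArg Prod.fst e)⟩
  omega

omit [Fintype H] in
theorem ncard_mul_eq_one {A : Set H} (hA : A⁻¹ = A) :
    {p : H × H | p.1 ∈ A ∧ p.2 ∈ A ∧ p.1 * p.2 = 1}.ncard = A.ncard := by
  have : {p : H × H | p.1 ∈ A ∧ p.2 ∈ A ∧ p.1 * p.2 = 1} = (fun a => (a, a⁻¹)) '' A := by
    ext ⟨a, b⟩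
    have ha : a⁻¹ ∈ A ↔ a ∈ A := by rw [← Set.mem_inv, hA]
    simp only [Set.mem_ofPred_eq, mul_eq_one_iff_eq_inv', Set.mem_image, Prod.mk.injEq]
    constructor
    · rintro ⟨h, -, rfl⟩
      exact ⟨a, h, rfl, rfl⟩
    · rintro ⟨_, h, rfl, rfl⟩
      exact ⟨h, ha.mpr h, rfl⟩
  rw [this, Set.ncard_image_of_injective _ fun _ _ h => congrArg Prod.fst h]

theorem theta0_eq_card (hH : (Nat.card H).Coprime 2) :
    theta0 T₀ T₁ = (Finset.univ.filter fun g : H =>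
      g ∈ T₀ ∪ T₁ ∧ g ^ 4 ∈ (T₀ * T₀) \ ((fun t => t ^ 2) '' T₀)).card := by
  have hinj : Function.Injective fun g : H => g ^ 4 :=
    (powCoprime (n := 4) (hH.pow_right 2)).injective
  have : ((T₀ * T₀) \ ((fun t => t ^ 2) '' T₀)) ∩ ((fun g => g ^ 4) '' (T₀ ∪ T₁)) =
      (fun g => g ^ 4) '' {g : H | g ∈ T₀ ∪ T₁ ∧ g ^ 4 ∈ (T₀ * T₀) \ ((fun t => t ^ 2) '' T₀)} := by
    ext x
    constructor
    · rintro ⟨hx, g, hg, rfl⟩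
      exact ⟨g, ⟨hg, hx⟩, rfl⟩
    · rintro ⟨g, ⟨hg, hx⟩, rfl⟩
      exact ⟨hx, g, hg, rfl⟩
  rw [theta0, this, Set.ncard_image_of_injective _ hinj,
    Set.ncard_eq_toFinset_card']
  congr 1
  ext
  simp only [Set.mem_toFinset, Finset.mem_filter_univ]
  rfl

theorem APLLEqs.coeff_powSum_four_mul (hA : APLLEqs n T₀ T₁) (hH : (Nat.card H).Coprime 2)
    (hT₀inv : T₀⁻¹ = T₀) (he : (1 : H) ∈ T₀) :
    (powSum ℤ 4 (T₀ ∪ T₁) * (powSum ℤ 1 T₀ * powSum ℤ 1 T₀)).coeff 1 =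
      T₀.ncard + 2 * theta0 T₀ T₁ := by
  have h4 : (Nat.card H).Coprime 4 := hH.pow_right 2
  have key : ∀ g ∈ Finset.univ.filter (fun g : H => g ∈ T₀ ∪ T₁),
      (powSum ℤ 1 T₀ * powSum ℤ 1 T₀).coeff ((g ^ 4)⁻¹ * 1) = (if g = 1 then (T₀.ncard : ℤ) else 0) +
        2 * if g ^ 4 ∈ (T₀ * T₀) \ ((fun t => t ^ 2) '' T₀) then 1 else 0 := by
    intro g hg
    rw [mul_one, coeff_powSum_mul_powSum, ncard_mul_eq_inv hT₀inv hT₀inv]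
    simp only [pow_one]
    rcases eq_or_ne g 1 with rfl | hg1
    · have : (1 : H) ∈ (fun t => t ^ 2) '' T₀ := ⟨1, he, one_pow 2⟩
      rw [one_pow, ncard_mul_eq_one hT₀inv, if_pos rfl, if_neg fun h => h.2 this]
      simp
    · have hg4 : g ^ 4 ≠ 1 := fun h => hg1 ((powCoprime h4).injective (by simpa using h))
      rw [if_neg hg1]
      split_ifs with hW
      · rw [hA.ncard_mul_eq hW.1 hW.2 hg4]
        simp
      · have hsq : g ^ 4 ∉ (fun t => t ^ 2) '' T₀ := by
          rintro ⟨t, ht, htg⟩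
          have : t = g ^ 2 := (powCoprime hH).injective (by
            simp only [powCoprime_apply]
            rw [← pow_mul]
            exact htg)
          exact hg1 (hA.eq_one_of_sq_mem hH he (by simpa using hg) (this ▸ ht))
        have : {p : H × H | p.1 ∈ T₀ ∧ p.2 ∈ T₀ ∧ p.1 * p.2 = g ^ 4} = ∅ :=
          Set.eq_empty_of_forall_notMem fun p hp => hW ⟨⟨p.1, hp.1, p.2, hp.2.1, hp.2.2⟩, hsq⟩
        simp [this]
  rw [coeff_powSum_mul]
  refine (Finset.sum_congr (by ext; simp) key).trans ?_
  rw [Finset.sum_add_distrib, ← Finset.mul_sum,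
    Finset.sum_boole, Finset.filter_filter, theta0_eq_card hH]
  simp [he]

/-- The coefficient of `h` in `T̂^{(2)} T₀`. -/
noncomputable def xCoeff (T₀ T₁ : Set H) (h : H) : ℕ :=
  {p : H × H | p.1 ∈ T₀ ∪ T₁ ∧ p.2 ∈ T₀ ∧ p.1 ^ 2 * p.2 = h}.ncard

theorem coeff_eq_xCoeff (T₀ T₁ : Set H) (h : H) :
    (powSum R 2 (T₀ ∪ T₁) * powSum R 1 T₀).coeff h = xCoeff T₀ T₁ h := by
  rw [coeff_powSum_mul_powSum]
  simp only [pow_one, xCoeff]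

omit [Fintype H] in
theorem xCoeff_inv (hT₀inv : T₀⁻¹ = T₀) (hT₁inv : T₁⁻¹ = T₁) (h : H) :
    xCoeff T₀ T₁ h⁻¹ = xCoeff T₀ T₁ h := by
  have := ncard_mul_eq_inv (A := T₀ ∪ T₁) (B := T₀) (by rw [Set.union_inv, hT₀inv, hT₁inv]) hT₀inv
    2 1 h
  simpa only [xCoeff, pow_one] using this

theorem sum_xCoeff (T₀ T₁ : Set H) :
    ∑ h, (xCoeff T₀ T₁ h : ℤ) = (T₀ ∪ T₁).ncard * T₀.ncard := by
  have h : powSum ℤ 2 (T₀ ∪ T₁) * powSum ℤ 1 T₀ * powSum ℤ 1 Set.univ =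
      (((T₀ ∪ T₁).ncard * T₀.ncard : ℕ) : MonoidAlgebra ℤ H) * powSum ℤ 1 Set.univ := by
    rw [mul_assoc, powSum_mul_univ, mul_left_comm, powSum_mul_univ]
    push_cast
    ring
  have h' := congrArg (fun x => x.coeff 1) h
  simp only [coeff_natCast_mul, coeff_powSum_univ] at h'
  rw [MonoidAlgebra.coeff_mul_one_eq_sum] at h'
  simpa [coeff_eq_xCoeff, coeff_powSum_univ] using h'

theorem APLLEqs.sum_xCoeff_sq (hA : APLLEqs n T₀ T₁) (hH : (Nat.card H).Coprime 2)
    (hT₀inv : T₀⁻¹ = T₀) (hT₁inv : T₁⁻¹ = T₁) (he : (1 : H) ∈ T₀) (h₀ : T₀.ncard = n) :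
    ∑ h, (xCoeff T₀ T₁ h : ℤ) ^ 2 = 6 * n ^ 2 - 3 * n - 2 * theta0 T₀ T₁ := by
  have h := congrArg (fun x => x.coeff 1)
    (hA.sq_powSum_two_mul (R := ℤ) (hA.disjoint_s6 hT₀inv) hH h₀)
  have hn : (powSum ℤ 1 T₀ * powSum ℤ 1 T₀).coeff 1 = n := by
    rw [coeff_powSum_mul_powSum]
    simp only [pow_one]
    rw [ncard_mul_eq_one hT₀inv, h₀]
  simp only [nsmul_eq_mul, MonoidAlgebra.coeff_add, Finsupp.add_apply, coeff_natCast_mul, hn,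
    hA.coeff_powSum_four_mul hH hT₀inv he, coeff_powSum_univ, h₀] at h
  rw [MonoidAlgebra.coeff_mul_one_eq_sum] at h
  simp only [coeff_eq_xCoeff, xCoeff_inv hT₀inv hT₁inv, ← sq] at h
  push_cast at h
  linarith

theorem APLLEqs.xCoeff_zmod_three (hA : APLLEqs n T₀ T₁) (hH : (Nat.card H).Coprime 3)
    (hd : Disjoint T₀ T₁) (h₀ : T₀.ncard = n) (h₁ : T₁.ncard = n + 1) (hn : n % 3 = 2) (h : H) :
    (xCoeff T₀ T₁ h : ZMod 3) + (if h ∈ (fun t => t ^ 3) '' T₀ then 1 else 0) =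
      1 + if h ∈ T₀ ∪ T₁ then 1 else 0 := by
  have hc := congrArg (fun x => x.coeff h) (hA.powSum_two_mul (R := ZMod 3) hd h₀ h₁)
  have hn' : (n : ZMod 3) = 2 := by
    rw [← ZMod.natCast_mod, hn]
    rfl
  have h3 : (3 : ZMod 3) = 0 := rfl
  simp only [powSum_one_pow_char, MonoidAlgebra.coeff_add, Finsupp.add_apply, coeff_natCast_mul,
    coeff_eq_xCoeff, coeff_powSum_of_coprime hH,
    coeff_powSum_of_coprime (Nat.coprime_one_right _), pow_one, Set.image_id'] at hc
  push_cast at hc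
  rw [hn', if_pos (Set.mem_univ h)] at hc
  have hT : (if h ∈ T₀ ∪ T₁ then (1 : ZMod 3) else 0) =
      (if h ∈ T₀ then 1 else 0) + if h ∈ T₁ then 1 else 0 := by
    have : h ∈ T₀ → h ∉ T₁ := fun hm => hd.notMem_of_mem_left hm
    by_cases hm₀ : h ∈ T₀ <;> by_cases hm₁ : h ∈ T₁ <;> simp_all
  rw [hT]
  linear_combination hc + (if h ∈ T₀ then (1 : ZMod 3) else 0) * h3

end APLL

theorem ncard_eq_sum_ite {α : Type*} [Fintype α] (S : Set α) :
    (S.ncard : ℚ) = ∑ a, if a ∈ S then 1 else 0 := by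
  rw [Finset.sum_boole, Set.ncard_eq_toFinset_card']
  congr 2
  ext; simp

theorem tsum_mul_ncard_fiber {α : Type*} [Fintype α] (c : α → ℕ) (f : ℕ → ℚ) :
    ∑' i, f i * ({a | c a = i}.ncard : ℚ) = ∑ a, f (c a) := by
  rw [Finset.sum_comp f c, tsum_eq_sum (s := Finset.univ.image c)]
  · refine Finset.sum_congr rfl fun i _ => ?_
    rw [nsmul_eq_mul, mul_comm, Set.ncard_eq_toFinset_card']
    congr 3
    ext; simp
  · intro i hi
    have : {a | c a = i} = ∅ :=
      Set.eq_empty_of_forall_notMem fun a ha => hi (Finset.mem_image.mpr ⟨a, by simp, ha⟩)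
    simp [this]

theorem residue_indicators {α : Type*} {m : ℕ} {a : α} {T C D : Set α} (hD : T ∩ C = D)
    (h : (m : ZMod 3) + (if a ∈ C then 1 else 0) = 1 + if a ∈ T then 1 else 0) :
    ((if m % 3 = 0 then (1 : ℚ) else 0) =
        (if a ∈ C then 1 else 0) - if a ∈ D then 1 else 0) ∧
      (if m % 3 = 2 then (1 : ℚ) else 0) =
        (if a ∈ T then 1 else 0) - if a ∈ D then 1 else 0 := by
  subst hD
  have key : ∀ r : ℕ, (m : ZMod 3) = (r : ℕ) → m % 3 = r % 3 :=
    fun r => (ZMod.natCast_eq_natCast_iff' m r 3).mp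
  by_cases hC : a ∈ C <;> by_cases hT : a ∈ T <;>
    simp only [hC, hT, if_true, if_false, add_zero, Set.mem_inter_iff, and_true,
      and_false, and_self] at h ⊢
  · simp [key 1 (by simpa using h)]
  · simp [key 0 (by simpa using h)]
  · simp [key 2 (by rw [h]; rfl)]
  · simp [key 1 (by simpa using h)]

theorem sum_residue_indicators (m : ℕ) :
    (if m % 3 = 0 then (1 : ℚ) else 0) + (if m % 3 = 1 then (1 : ℚ) else 0) +
      (if m % 3 = 2 then (1 : ℚ) else 0) = 1 := by
  have : m % 3 < 3 := Nat.mod_lt _ (by norm_num)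
  interval_cases m % 3 <;> simp

theorem sCoef_eq (i : ℕ) :
    sCoef i = ((i : ℚ) ^ 2 - 5 * i + 6) / 2 - if i % 3 = 1 then 1 else 0 := by
  unfold sCoef
  split_ifs <;> ring

theorem sCoef_nonneg (i : ℕ) : 0 ≤ sCoef i := by
  rcases lt_or_ge i 5 with hi | hi
  · interval_cases i <;> norm_num [sCoef]
  · have : (5 : ℚ) ≤ i := by exact_mod_cast hi
    unfold sCoef
    split_ifs <;> nlinarith

theorem sCoef_eq_add_ite (i : ℕ) :
    sCoef i = 3 * (if i = 0 then 1 else 0) + if 5 ≤ i then sCoef i else 0 := by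
  rcases lt_or_ge i 5 with hi | hi
  · interval_cases i <;> norm_num [sCoef]
  · simp [hi, show i ≠ 0 by omega]

/-- A function of `i` agreeing with `3 * [i = 1]` for `1 ≤ i ≤ 4`, and depending only on `i` and
its residue class modulo `3`. -/
def levelOneApprox (i : ℕ) : ℚ :=
  4 * (if i % 3 = 1 then 1 else 0) - i + 2 * (if i % 3 = 2 then 1 else 0) +
    3 * (if i % 3 = 0 then 1 else 0)

theorem level_one_bounds (i : ℕ) :
    levelOneApprox i - sCoef i ≤ 3 * (if i = 1 then 1 else 0) ∧
      3 * (if i = 1 then 1 else 0) ≤ levelOneApprox i + sCoef i := by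
  rcases lt_or_ge i 5 with hi | hi
  · interval_cases i <;> norm_num [sCoef, levelOneApprox]
  · have : (5 : ℚ) ≤ i := by exact_mod_cast hi
    have h3 : i % 3 < 3 := Nat.mod_lt _ (by norm_num)
    rw [if_neg (show i ≠ 1 by omega), levelOneApprox, sCoef]
    generalize i % 3 = r at h3
    interval_cases r <;> norm_num <;> constructor <;> nlinarith

theorem level_four_bounds (i : ℕ) :
    3 * (if i % 3 = 1 then 1 else 0) - levelOneApprox i - sCoef i ≤ 3 * (if i = 4 then 1 else 0) ∧
      3 * (if i = 4 then 1 else 0) ≤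
        3 * (if i % 3 = 1 then 1 else 0) - levelOneApprox i + sCoef i := by
  rcases lt_or_ge i 5 with hi | hi
  · interval_cases i <;> norm_num [sCoef, levelOneApprox]
  · have h5 : (5 : ℚ) ≤ i := by exact_mod_cast hi
    have h3 : i % 3 < 3 := Nat.mod_lt _ (by norm_num)
    have h7 : i % 3 = 1 → (7 : ℚ) ≤ i := fun h => by exact_mod_cast (by omega : 7 ≤ i)
    rw [if_neg (show i ≠ 4 by omega), levelOneApprox, sCoef]
    generalize i % 3 = r at h3 h7
    interval_cases r <;> norm_num <;> constructor <;>
      first | nlinarith | nlinarith [h7 rfl]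

/-- For `n ≡ 5 (mod 6)`, bounds on `|X₀|`, `Σ_{i≥5} s_i|X_i|`, `|X₁|` and `|X₄|`
in terms of `ℓ₀ = |T₁ ∩ T₀⁽³⁾|` and `θ₀`. -/
theorem Xi_bounds_n_eq_five_mod_six (n : ℕ) (hn : 0 < n) (hmod : n % 6 = 5)
    {H : Type*} [CommGroup H] [Fintype H]
    (hcard : Fintype.card H = n ^ 2 + n + 1)
    (T₀ T₁ : Set H) (hT₀inv : T₀⁻¹ = T₀) (hT₁inv : T₁⁻¹ = T₁)
    (he : (1 : H) ∈ T₀) (hk : T₀.ncard + T₁.ncard = 2 * n + 1)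
    (hAPLL : APLLEqs n T₀ T₁)
    (ℓ₀ : ℕ) (hℓ₀ : ℓ₀ = (T₁ ∩ ((fun t => t ^ 3) '' T₀)).ncard) :
    3 * ((Xset T₀ T₁ 0).ncard : ℚ) ≤ (n : ℚ) - 2 * ℓ₀ + 1 - theta0 T₀ T₁ ∧
    (∑' i : ℕ, if 5 ≤ i then sCoef i * ((Xset T₀ T₁ i).ncard : ℚ) else 0)
      ≤ (n : ℚ) - 2 * ℓ₀ + 1 - theta0 T₀ T₁ ∧
    (2 * (n : ℚ) ^ 2 - 4 * n + 7 * ℓ₀ + 3 + 2 * theta0 T₀ T₁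
        ≤ 3 * ((Xset T₀ T₁ 1).ncard : ℚ) ∧
      3 * ((Xset T₀ T₁ 1).ncard : ℚ)
        ≤ 2 * (n : ℚ) ^ 2 - ℓ₀ + 7 - 2 * theta0 T₀ T₁) ∧
    ((n : ℚ) ^ 2 - 6 * n + 7 * ℓ₀ - 1 + 2 * theta0 T₀ T₁
        ≤ 3 * ((Xset T₀ T₁ 4).ncard : ℚ) ∧
      3 * ((Xset T₀ T₁ 4).ncard : ℚ)
        ≤ (n : ℚ) ^ 2 - 3 * n + ℓ₀ + 2 - theta0 T₀ T₁) := by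
  have h3n : ¬ 3 ∣ n ^ 2 + n + 1 := by
    have : n % 3 = 2 := by omega
    rw [Nat.dvd_iff_mod_eq_zero]
    simp [Nat.add_mod, Nat.pow_mod, this]
  have h2n : ¬ 2 ∣ n ^ 2 + n + 1 := by
    have : n % 2 = 1 := by omega
    rw [Nat.dvd_iff_mod_eq_zero]
    simp [Nat.add_mod, Nat.pow_mod, this]
  have hH2 : (Nat.card H).Coprime 2 := by
    rw [Nat.card_eq_fintype_card, hcard]
    exact ((Nat.Prime.coprime_iff_not_dvd Nat.prime_two).mpr h2n).symm
  have hH3 : (Nat.card H).Coprime 3 := by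
    rw [Nat.card_eq_fintype_card, hcard]
    exact ((Nat.Prime.coprime_iff_not_dvd Nat.prime_three).mpr h3n).symm
  have hd := hAPLL.disjoint_s6 hT₀inv
  have h₀ : T₀.ncard = n := by
    have hprod := hAPLL.ncard_mul_ncard_s6
    obtain ⟨m, hm⟩ := odd_ncard_of_inv_eq_s6 hH2 hT₀inv he
    have hfac : ((T₀.ncard : ℤ) - n) * (T₀.ncard - (n + 1)) = 0 := by
      have hk' : (T₀.ncard : ℤ) + T₁.ncard = 2 * n + 1 := by exact_mod_cast hk
      have hprod' : (T₀.ncard : ℤ) * T₁.ncard + 1 = n ^ 2 + n + 1 := by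
        exact_mod_cast hprod.trans hcard
      linear_combination (T₀.ncard : ℤ) * hk' - hprod'
    rcases mul_eq_zero.mp hfac with h | h <;> omega
  have h₁ : T₁.ncard = n + 1 := by omega
  have hTcard : (T₀ ∪ T₁).ncard = 2 * n + 1 := by rw [Set.ncard_union_eq hd, hk]
  set c := xCoeff T₀ T₁ with hc
  set C : Set H := (fun t => t ^ 3) '' T₀ with hC
  have hX : ∀ i, ((Xset T₀ T₁ i).ncard : ℚ) = ∑ h, if c h = i then 1 else 0 :=
    fun i => (ncard_eq_sum_ite _).trans <|
      Finset.sum_congr rfl fun h _ => if_congr Iff.rfl rfl rfl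
  have hCcard : C.ncard = n := by
    rw [hC, Set.ncard_image_of_injective _ (show Function.Injective fun t : H => t ^ 3 from
      (powCoprime hH3).injective), h₀]
  have hTC : ((T₀ ∪ T₁) ∩ C).ncard = ℓ₀ + 1 := by
    have h1 : (1 : H) ∉ T₁ ∩ C := fun h => hd.notMem_of_mem_left he h.1
    have : (T₀ ∪ T₁) ∩ C = insert 1 (T₁ ∩ C) := by
      ext x
      constructor
      · rintro ⟨hx | hx, hxC⟩
        · obtain ⟨t, ht, rfl⟩ := hxC
          left
          simp [hAPLL.eq_one_of_cube_mem hH2 hT₀inv ht hx]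
        · exact Or.inr ⟨hx, hxC⟩
      · rintro (rfl | ⟨hx, hxC⟩)
        · exact ⟨Or.inl he, 1, he, one_pow 3⟩
        · exact ⟨Or.inr hx, hxC⟩
    rw [this, Set.ncard_insert_of_notMem h1, hℓ₀]
  have hres := fun h => residue_indicators (m := c h) (a := h) (T := T₀ ∪ T₁) (C := C) rfl
    (by convert hAPLL.xCoeff_zmod_three hH3 hd h₀ h₁ (by omega) h)
  have hT' := ncard_eq_sum_ite (T₀ ∪ T₁)
  have hC' := ncard_eq_sum_ite C
  have hTC' := ncard_eq_sum_ite ((T₀ ∪ T₁) ∩ C)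
  rw [hTcard] at hT'
  rw [hCcard] at hC'
  rw [hTC] at hTC'
  push_cast at hT' hTC'
  have hN0 : ∑ h, (if c h % 3 = 0 then (1 : ℚ) else 0) = n - 1 - ℓ₀ := by
    rw [Finset.sum_congr rfl fun h _ => (hres h).1, Finset.sum_sub_distrib, ← hC', ← hTC']
    ring
  have hN2 : ∑ h, (if c h % 3 = 2 then (1 : ℚ) else 0) = 2 * n - ℓ₀ := by
    rw [Finset.sum_congr rfl fun h _ => (hres h).2, Finset.sum_sub_distrib, ← hT', ← hTC']
    ring
  have hN1 : ∑ h, (if c h % 3 = 1 then (1 : ℚ) else 0) = n ^ 2 - 2 * n + 2 + 2 * ℓ₀ := by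
    have hsum : ∑ h, ((if c h % 3 = 0 then (1 : ℚ) else 0) + (if c h % 3 = 1 then (1 : ℚ) else 0) +
        if c h % 3 = 2 then (1 : ℚ) else 0) = n ^ 2 + n + 1 := by
      rw [Finset.sum_congr rfl fun h _ => sum_residue_indicators (c h)]
      simp [hcard]
    rw [Finset.sum_add_distrib, Finset.sum_add_distrib, hN0, hN2] at hsum
    linarith
  have hS1 : ∑ h, (c h : ℚ) = 2 * n ^ 2 + n := by
    have h := sum_xCoeff T₀ T₁
    rw [hTcard, h₀] at h
    have h' : ((∑ h, (c h : ℤ) : ℤ) : ℚ) = (((2 * n + 1 : ℕ) * n : ℤ) : ℚ) := congrArg _ h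
    push_cast at h'
    linarith
  have hS2 : ∑ h, (c h : ℚ) ^ 2 = 6 * n ^ 2 - 3 * n - 2 * theta0 T₀ T₁ := by
    have h := hAPLL.sum_xCoeff_sq hH2 hT₀inv hT₁inv he h₀
    have h' : ((∑ h, (c h : ℤ) ^ 2 : ℤ) : ℚ) = ((6 * n ^ 2 - 3 * n - 2 * theta0 T₀ T₁ : ℤ) : ℚ) :=
      congrArg _ h
    push_cast at h'
    exact h'
  have hE : ∑ h, sCoef (c h) = n - 2 * ℓ₀ + 1 - theta0 T₀ T₁ := by
    simp only [sCoef_eq, Finset.sum_sub_distrib, Finset.sum_add_distrib, ← Finset.sum_div,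
      ← Finset.mul_sum, hS1, hS2, hN1, Finset.sum_const, Finset.card_univ, hcard, nsmul_eq_mul]
    push_cast
    ring
  have hsplit : 3 * ((Xset T₀ T₁ 0).ncard : ℚ) + ∑ h, (if 5 ≤ c h then sCoef (c h) else 0) =
      n - 2 * ℓ₀ + 1 - theta0 T₀ T₁ := by
    rw [hX, Finset.mul_sum, ← Finset.sum_add_distrib, ← hE]
    exact Finset.sum_congr rfl fun h _ => (sCoef_eq_add_ite (c h)).symm
  have htail : (∑' i : ℕ, if 5 ≤ i then sCoef i * ((Xset T₀ T₁ i).ncard : ℚ) else 0) =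
      ∑ h, if 5 ≤ c h then sCoef (c h) else 0 := by
    rw [← tsum_mul_ncard_fiber c fun i => if 5 ≤ i then sCoef i else 0]
    exact tsum_congr fun i => by rw [ite_mul, zero_mul]; rfl
  have htail0 : 0 ≤ ∑ h, (if 5 ≤ c h then sCoef (c h) else 0) :=
    Finset.sum_nonneg fun h _ => by split_ifs <;> simp [sCoef_nonneg]
  have hX0 : 0 ≤ ((Xset T₀ T₁ 0).ncard : ℚ) := Nat.cast_nonneg _
  have hB : ∑ h, levelOneApprox (c h) = 2 * n ^ 2 - 2 * n + 5 + 3 * ℓ₀ := by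
    simp only [levelOneApprox, Finset.sum_sub_distrib, Finset.sum_add_distrib, ← Finset.mul_sum,
      hS1, hN0, hN1, hN2]
    ring
  have hB4 : ∑ h, (3 * (if c h % 3 = 1 then (1 : ℚ) else 0) - levelOneApprox (c h)) =
      n ^ 2 - 4 * n + 1 + 3 * ℓ₀ := by
    rw [Finset.sum_sub_distrib, ← Finset.mul_sum, hB, hN1]
    ring
  have h1 := Finset.sum_le_sum fun h (_ : h ∈ Finset.univ) => (level_one_bounds (c h)).1
  have h1' := Finset.sum_le_sum fun h (_ : h ∈ Finset.univ) => (level_one_bounds (c h)).2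
  have h4 := Finset.sum_le_sum fun h (_ : h ∈ Finset.univ) => (level_four_bounds (c h)).1
  have h4' := Finset.sum_le_sum fun h (_ : h ∈ Finset.univ) => (level_four_bounds (c h)).2
  simp only [Finset.sum_sub_distrib _ (fun h => sCoef (c h)), Finset.sum_add_distrib,
    ← Finset.mul_sum, hE, hB] at h1 h1'
  rw [Finset.sum_sub_distrib _ (fun h => sCoef (c h)), hB4, hE, ← Finset.mul_sum] at h4
  rw [Finset.sum_add_distrib, hB4, hE, ← Finset.mul_sum] at h4'
  rw [← hX] at h1 h1' h4 h4'
  rw [htail]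
  refine ⟨?_, ?_, ⟨?_, ?_⟩, ?_, ?_⟩ <;> linarith
end
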